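/- Every GC_5 set of 21 nodes in the real plane possesses a maximal line, i.e., a line passing through exactly 6 of its nodes. -/

import Mathlib

open MvPolynomial

/-- Evaluation of a bivariate polynomial at a point of the real plane. -/
noncomputable def ev (p : MvPolynomial (Fin 2) ℝ) (A : ℝ × ℝ) : ℝ :=
  MvPolynomial.eval ![A.1, A.2] p

/-- A polynomial of total degree exactly 1, defining a line. -/
def IsLinePoly (l : MvPolynomial (Fin 2) ℝ) : Prop := l.totalDegree = 1

/-- The line (zero set) defined by a polynomial. -/
def lineSet (l : MvPolynomial (Fin 2) ℝ) : Set (ℝ × ℝ) := {A | ev l A = 0}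

/-- The number of nodes of `X` lying on the line defined by `l`. -/
noncomputable def nodesOn (X : Set (ℝ × ℝ)) (l : MvPolynomial (Fin 2) ℝ) : ℕ :=
  (X ∩ lineSet l).ncard

/-- `X` is an `n`-poised set: it has `N = (n+2)(n+1)/2` nodes and the only polynomial of
degree ≤ n vanishing on all of `X` is the zero polynomial. -/
def Poised (n : ℕ) (X : Set (ℝ × ℝ)) : Prop :=
  X.Finite ∧ X.ncard = (n + 2) * (n + 1) / 2 ∧
    ∀ p : MvPolynomial (Fin 2) ℝ, p.totalDegree ≤ n → (∀ A ∈ X, ev p A = 0) → p = 0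

/-- `p` is an `n`-fundamental polynomial of the node `A` with respect to `X`. -/
def IsFund (n : ℕ) (X : Set (ℝ × ℝ)) (A : ℝ × ℝ) (p : MvPolynomial (Fin 2) ℝ) : Prop :=
  p.totalDegree ≤ n ∧ ev p A = 1 ∧ ∀ B ∈ X, B ≠ A → ev p B = 0

/-- `X` is a `GC_n` set: it is `n`-poised and each fundamental polynomial is a product of
`n` linear (degree-1) polynomials. -/
def GCSet (n : ℕ) (X : Set (ℝ × ℝ)) : Prop :=
  Poised n X ∧ ∀ A ∈ X, ∃ p : MvPolynomial (Fin 2) ℝ, IsFund n X A p ∧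
    ∃ f : Fin n → MvPolynomial (Fin 2) ℝ, (∀ i, IsLinePoly (f i)) ∧ p = ∏ i, f i

/-- The node `A` uses the line `l`: the linear polynomial `l` divides a fundamental
polynomial of `A`. -/
def Uses (n : ℕ) (X : Set (ℝ × ℝ)) (A : ℝ × ℝ) (l : MvPolynomial (Fin 2) ℝ) : Prop :=
  ∃ p, IsFund n X A p ∧ l ∣ p

/-- `X` has no maximal line, i.e. no line passes through `n+1` nodes of `X`. -/
def NoMaximalLine (n : ℕ) (X : Set (ℝ × ℝ)) : Prop :=
  ∀ l : MvPolynomial (Fin 2) ℝ, IsLinePoly l → nodesOn X l ≠ n + 1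

section LineSystem

variable {P : Type*} [DecidableEq P]

/-- All members of the families `L A`, for `A` in `X`. -/
def lines (X : Finset P) (L : P → Finset (Finset P)) : Finset (Finset P) := X.biUnion L

/-- The nodes `A` whose family `L A` contains `h`. -/
def users (X : Finset P) (L : P → Finset (Finset P)) (h : Finset P) : Finset P :=
  X.filter fun A => h ∈ L A

/-- Three pairwise disjoint five-node lines. -/
structure IsTriple (X : Finset P) (L : P → Finset (Finset P)) (t : Fin 3 → Finset P) : Prop where
  mem : ∀ i, t i ∈ lines X L
  card : ∀ i, (t i).card = 5
  disj : ∀ i j, i ≠ j → Disjoint (t i) (t j)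

/-- The nodes on none of the three lines. -/
def rest (X : Finset P) (t : Fin 3 → Finset P) : Finset P := X \ Finset.univ.biUnion t

/-- The incidence properties of the lines used by the nodes of a `GC_5` set
without maximal line. -/
structure LineSystem (X : Finset P) (L : P → Finset (Finset P)) : Prop where
  card_nodes : X.card = 21
  card_lines : ∀ A ∈ X, (L A).card = 5
  subset : ∀ A ∈ X, ∀ h ∈ L A, h ⊆ X
  notMem : ∀ A ∈ X, ∀ h ∈ L A, A ∉ h
  two_le : ∀ A ∈ X, ∀ h ∈ L A, 2 ≤ h.card
  le_five : ∀ A ∈ X, ∀ h ∈ L A, h.card ≤ 5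
  cover : ∀ A ∈ X, ∀ C ∈ X, C ≠ A → ∃ h ∈ L A, C ∈ h
  inter_le_one : ∀ h ∈ lines X L, ∀ h' ∈ lines X L, h ≠ h' → (h ∩ h').card ≤ 1
  users_two : ∀ A ∈ X, ∀ h ∈ L A, h.card = 2 → (users X L h).card ≤ 1
  users_three : ∀ A ∈ X, ∀ h ∈ L A, h.card = 3 → 3 ≤ (users X L h).card →
    ∃ t, IsTriple X L t ∧ A ∈ rest X t
  users_four : ∀ A ∈ X, ∀ h ∈ L A, h.card = 4 → (users X L h).card ≤ 3
  users_four_eq : ∀ A ∈ X, ∀ h ∈ L A, h.card = 4 → 3 ≤ (users X L h).card →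
    2 ≤ ((L A).filter fun g => g.card = 5).card
  users_five_le : ∀ A ∈ X, ∀ h ∈ L A, h.card = 5 → (users X L h).card ≤ 6
  users_five : ∀ A ∈ X, ∀ h ∈ L A, h.card = 5 → 5 ≤ (users X L h).card →
    ∃ t, IsTriple X L t ∧ A ∈ rest X t
  triple_mem : ∀ t, IsTriple X L t → ∀ A ∈ rest X t, ∀ i, t i ∈ L A
  mem_of_three : ∀ t, IsTriple X L t → ∀ h ∈ lines X L, (h ∩ rest X t).card = 3 →
    ∀ A ∈ rest X t, A ∉ h → h ∈ L A
  inter_rest : ∀ t, IsTriple X L t → ∀ h ∈ lines X L, (h ∩ rest X t).card ≤ 3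
  not_cover : ∀ t, IsTriple X L t → ∀ h ∈ lines X L, ∀ h' ∈ lines X L, ¬ rest X t ⊆ h ∪ h'

variable {X : Finset P} {L : P → Finset (Finset P)}

lemma mem_lines {h : Finset P} : h ∈ lines X L ↔ ∃ A ∈ X, h ∈ L A := by simp [lines]

lemma mem_users {h : Finset P} {A : P} : A ∈ users X L h ↔ A ∈ X ∧ h ∈ L A := by simp [users]

lemma sum_users {S : Finset P} (hS : S ⊆ X) (φ : P → Finset P → ℤ) :
    ∑ A ∈ S, ∑ h ∈ L A, φ A h = ∑ h ∈ lines X L, ∑ A ∈ users X L h ∩ S, φ A h := by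
  apply Finset.sum_comm'
  intro A h
  simp only [mem_lines, Finset.mem_inter, mem_users]
  constructor
  · rintro ⟨h1, h2⟩
    exact ⟨⟨⟨hS h1, h2⟩, h1⟩, A, hS h1, h2⟩
  · rintro ⟨⟨⟨_, h2⟩, h1⟩, _⟩
    exact ⟨h1, h2⟩

/-- Distinct lines meet in at most one node, so they contain disjoint sets of pairs. -/
lemma sum_mul_le {F : Finset (Finset P)}
    (hF : ∀ h ∈ F, ∀ h' ∈ F, h ≠ h' → (h ∩ h').card ≤ 1) {S T : Finset P} (hST : Disjoint S T) :
    ∑ h ∈ F, (h ∩ S).card * (h ∩ T).card ≤ S.card * T.card := by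
  have h1 : ∑ h ∈ F, (h ∩ S).card * (h ∩ T).card =
      (F.biUnion fun h => (h ∩ S) ×ˢ (h ∩ T)).card := by
    rw [Finset.card_biUnion]
    · simp
    · intro h hh h' hh' hne
      rw [Function.onFun, Finset.disjoint_left]
      rintro ⟨a, b⟩ hab hab'
      simp only [Finset.mem_product, Finset.mem_inter] at hab hab'
      have := Finset.card_le_one.mp (hF h hh h' hh' hne) a (by simp [hab, hab']) b
        (by simp [hab, hab'])
      subst this
      exact Finset.disjoint_left.mp hST hab.1.2 hab.2.2
  rw [h1, ← Finset.card_product]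
  apply Finset.card_le_card
  rintro ⟨a, b⟩
  simp only [Finset.mem_biUnion, Finset.mem_product, Finset.mem_inter]
  tauto

lemma sum_offDiag_le {F : Finset (Finset P)}
    (hF : ∀ h ∈ F, ∀ h' ∈ F, h ≠ h' → (h ∩ h').card ≤ 1) (S : Finset P) :
    ∑ h ∈ F, ((h ∩ S).card * (h ∩ S).card - (h ∩ S).card) ≤ S.card * S.card - S.card := by
  have h1 : ∑ h ∈ F, ((h ∩ S).card * (h ∩ S).card - (h ∩ S).card) =
      (F.biUnion fun h => (h ∩ S).offDiag).card := by
    rw [Finset.card_biUnion]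
    · simp
    · intro h hh h' hh' hne
      rw [Function.onFun, Finset.disjoint_left]
      rintro ⟨a, b⟩ hab hab'
      simp only [Finset.mem_offDiag, Finset.mem_inter] at hab hab'
      exact hab.2.2 (Finset.card_le_one.mp (hF h hh h' hh' hne) a (by simp [hab, hab']) b
        (by simp [hab, hab']))
  rw [h1, ← Finset.offDiag_card]
  apply Finset.card_le_card
  rintro ⟨a, b⟩
  simp only [Finset.mem_biUnion, Finset.mem_offDiag, Finset.mem_inter]
  tauto

lemma mem_rest {t : Fin 3 → Finset P} {A : P} : A ∈ rest X t ↔ A ∈ X ∧ ∀ i, A ∉ t i := by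
  simp [rest]

lemma card_rest_of_card_eq (hX : X.card = 21) {t : Fin 3 → Finset P} (ht : IsTriple X L t)
    (hsub : ∀ i, t i ⊆ X) : (rest X t).card = 6 := by
  rw [rest, Finset.card_sdiff_of_subset (by simpa using hsub), hX,
    Finset.card_biUnion fun i _ j _ hij => ht.disj i j hij]
  simp [ht.card]

namespace LineSystem

variable (hs : LineSystem X L)
include hs

lemma card_le_sum {A : P} (hA : A ∈ X) {S : Finset P} (hSX : S ⊆ X) (hAS : A ∉ S) :
    S.card ≤ ∑ h ∈ L A, (h ∩ S).card := by
  refine le_trans (Finset.card_le_card ?_) Finset.card_biUnion_le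
  intro C hC
  obtain ⟨h, hh, hCh⟩ := hs.cover A hA C (hSX hC) (by rintro rfl; exact hAS hC)
  exact Finset.mem_biUnion.mpr ⟨h, hh, by simp [hCh, hC]⟩

lemma twenty_le_sum {A : P} (hA : A ∈ X) : 20 ≤ ∑ h ∈ L A, h.card := by
  have := hs.card_le_sum hA (Finset.erase_subset A X) (Finset.notMem_erase A X)
  rw [Finset.card_erase_of_mem hA, hs.card_nodes] at this
  exact this.trans (Finset.sum_le_sum fun h _ => Finset.card_le_card Finset.inter_subset_left)

lemma eq_of_two {h h' : Finset P} (hh : h ∈ lines X L) (hh' : h' ∈ lines X L) {a b : P}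
    (hab : a ≠ b) (ha : a ∈ h) (hb : b ∈ h) (ha' : a ∈ h') (hb' : b ∈ h') : h = h' := by
  by_contra hne
  exact hab (Finset.card_le_one.mp (hs.inter_le_one h hh h' hh' hne) a (by simp [*]) b
    (by simp [*]))

lemma disjoint_of_sum_le {A : P} (hA : A ∈ X) (hsum : ∑ h ∈ L A, h.card ≤ 20)
    {h₁ h₂ : Finset P} (hh₁ : h₁ ∈ L A) (hh₂ : h₂ ∈ L A) (hne : h₁ ≠ h₂) : Disjoint h₁ h₂ := by
  rw [Finset.disjoint_left]
  intro C hC₁ hC₂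
  have hCA : C ≠ A := by rintro rfl; exact hs.notMem _ hA _ hh₁ hC₁
  have hCX : C ∈ X := hs.subset A hA h₁ hh₁ hC₁
  have h1 := hs.card_le_sum hA (S := (X.erase A).erase C)
    ((Finset.erase_subset _ _).trans (Finset.erase_subset _ _)) (by simp)
  rw [Finset.card_erase_of_mem (by simp [hCA, hCX]), Finset.card_erase_of_mem hA,
    hs.card_nodes] at h1
  have h2 : 1 < ((L A).filter fun h => C ∈ h).card :=
    Finset.one_lt_card.mpr ⟨h₁, by simp [hh₁, hC₁], h₂, by simp [hh₂, hC₂], hne⟩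
  rw [Finset.card_filter] at h2
  have h3 : ∑ h ∈ L A, ((h ∩ (X.erase A).erase C).card + if C ∈ h then 1 else 0) ≤
      ∑ h ∈ L A, h.card := by
    refine Finset.sum_le_sum fun h _ => ?_
    split_ifs with hC
    · rw [← Finset.card_erase_add_one hC]
      gcongr
      intro x
      simp +contextual
    · exact Finset.card_le_card Finset.inter_subset_left
  rw [Finset.sum_add_distrib] at h3
  omega

lemma card_filter_five_le_two {A : P} (hA : A ∈ X) (hno : ∀ t, ¬ IsTriple X L t)
    (hsum : ∑ h ∈ L A, h.card ≤ 20) : ((L A).filter fun g => g.card = 5).card ≤ 2 := by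
  by_contra! hlt
  obtain ⟨a, ha, b, hb, c, hc, hab, hac, hbc⟩ := Finset.two_lt_card.mp hlt
  simp only [Finset.mem_filter] at ha hb hc
  have dab := hs.disjoint_of_sum_le hA hsum ha.1 hb.1 hab
  have dac := hs.disjoint_of_sum_le hA hsum ha.1 hc.1 hac
  have dbc := hs.disjoint_of_sum_le hA hsum hb.1 hc.1 hbc
  refine hno ![a, b, c] ⟨?_, ?_, ?_⟩
  · intro i
    fin_cases i
    exacts [mem_lines.mpr ⟨A, hA, ha.1⟩, mem_lines.mpr ⟨A, hA, hb.1⟩, mem_lines.mpr ⟨A, hA, hc.1⟩]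
  · intro i
    fin_cases i
    exacts [ha.2, hb.2, hc.2]
  · intro i j hij
    fin_cases i <;> fin_cases j <;> first | exact absurd rfl hij | skip
    exacts [dab, dac, dab.symm, dbc, dac.symm, dbc.symm]

/-- A lower bound, in terms of the size `c` of a line used by a node with `f` five-node lines,
for the number of ordered pairs on the line per user of the line. -/
def share (f c : ℕ) : ℚ :=
  if c = 5 then 5 else if c = 4 then (if 2 ≤ f then 4 else 6) else if c = 3 then 3 else 2

omit hs in
lemma le_div_users {c u b : ℚ} (hu : 0 < u) (h : b * u ≤ c) : b ≤ c / u :=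
  (le_div_iff₀ hu).mpr h

omit hs in
lemma users_pos {A : P} (hA : A ∈ X) {h : Finset P} (hh : h ∈ L A) :
    0 < (users X L h).card :=
  Finset.card_pos.mpr ⟨A, mem_users.mpr ⟨hA, hh⟩⟩

lemma share_le (hno : ∀ t, ¬ IsTriple X L t) {A : P} (hA : A ∈ X) {h : Finset P} (hh : h ∈ L A) :
    share ((L A).filter fun g => g.card = 5).card h.card ≤
      (h.card * (h.card - 1) : ℚ) / (users X L h).card := by
  have hpos : (0 : ℚ) < (users X L h).card := by exact_mod_cast users_pos hA hh
  apply le_div_users hpos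
  have h2 := hs.two_le A hA h hh
  have h5 := hs.le_five A hA h hh
  obtain hc | hc | hc | hc : h.card = 2 ∨ h.card = 3 ∨ h.card = 4 ∨ h.card = 5 := by omega
  · norm_num [share, hc]
    exact hs.users_two A hA h hh hc
  · have : (users X L h).card ≤ 2 := by
      by_contra! hlt
      obtain ⟨t, ht, -⟩ := hs.users_three A hA h hh hc hlt
      exact hno t ht
    have : ((users X L h).card : ℚ) ≤ 2 := by exact_mod_cast this
    norm_num [share, hc]
    linarith
  · have hu := hs.users_four A hA h hh hc
    by_cases hf : 2 ≤ ((L A).filter fun g => g.card = 5).card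
    · have : ((users X L h).card : ℚ) ≤ 3 := by exact_mod_cast hu
      norm_num [share, hc, hf]
      linarith
    · have : (users X L h).card ≤ 2 := by
        by_contra! hlt
        exact hf (hs.users_four_eq A hA h hh hc hlt)
      have : ((users X L h).card : ℚ) ≤ 2 := by exact_mod_cast this
      norm_num [share, hc, hf]
      linarith
  · have : (users X L h).card ≤ 4 := by
      by_contra! hlt
      obtain ⟨t, ht, -⟩ := hs.users_five A hA h hh hc hlt
      exact hno t ht
    have : ((users X L h).card : ℚ) ≤ 4 := by exact_mod_cast this
    norm_num [share, hc]
    linarith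

lemma sum_by_card {A : P} (hA : A ∈ X) {M : Type*} [CommSemiring M] (φ : ℕ → M) :
    ∑ h ∈ L A, φ h.card = ((L A).filter fun g => g.card = 2).card * φ 2 +
      ((L A).filter fun g => g.card = 3).card * φ 3 +
      ((L A).filter fun g => g.card = 4).card * φ 4 +
      ((L A).filter fun g => g.card = 5).card * φ 5 := by
  simp only [Finset.card_filter, Nat.cast_sum, Finset.sum_mul, ← Finset.sum_add_distrib]
  refine Finset.sum_congr rfl fun h hh => ?_
  have h2 := hs.two_le A hA h hh
  have h5 := hs.le_five A hA h hh
  obtain hc | hc | hc | hc : h.card = 2 ∨ h.card = 3 ∨ h.card = 4 ∨ h.card = 5 := by omega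
  all_goals simp [hc]

lemma le_sum_share (hno : ∀ t, ¬ IsTriple X L t) {A : P} (hA : A ∈ X) :
    20 ≤ ∑ h ∈ L A, share ((L A).filter fun g => g.card = 5).card h.card ∧
    (∑ h ∈ L A, share ((L A).filter fun g => g.card = 5).card h.card = 20 →
      ((L A).filter fun g => g.card = 5).card = 2) := by
  have hsum := hs.twenty_le_sum hA
  have hfive := hs.card_filter_five_le_two hA hno
  have hcard : ∑ h ∈ L A, 1 = 5 := by simpa using hs.card_lines A hA
  rw [hs.sum_by_card hA (fun c => c)] at hsum hfive
  rw [hs.sum_by_card hA (fun _ => 1)] at hcard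
  rw [hs.sum_by_card hA (share _)]
  generalize ((L A).filter fun g => g.card = 2).card = n2 at *
  generalize ((L A).filter fun g => g.card = 3).card = n3 at *
  generalize ((L A).filter fun g => g.card = 4).card = n4 at *
  generalize ((L A).filter fun g => g.card = 5).card = n5 at *
  simp only [Nat.cast_id] at *
  by_cases hn : 2 ≤ n5
  · norm_num [share, hn]
    norm_cast
    omega
  · norm_num [share, hn]
    norm_cast
    omega

theorem exists_triple : ∃ t, IsTriple X L t := by
  by_contra! hno
  have hle : ∀ A ∈ X, (20 : ℚ) ≤
      ∑ h ∈ L A, (h.card * (h.card - 1) : ℚ) / (users X L h).card := fun A hA =>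
    (hs.le_sum_share hno hA).1.trans (Finset.sum_le_sum fun h hh => hs.share_le hno hA hh)
  have htot : ∑ A ∈ X, ∑ h ∈ L A, (h.card * (h.card - 1) : ℚ) / (users X L h).card ≤
      ∑ A ∈ X, 20 := by
    have h1 : ∑ A ∈ X, ∑ h ∈ L A, (h.card * (h.card - 1) : ℚ) / (users X L h).card =
        ∑ h ∈ lines X L, ∑ A ∈ users X L h,
          (h.card * (h.card - 1) : ℚ) / (users X L h).card := by
      apply Finset.sum_comm'
      intro A h
      simp only [mem_lines, mem_users]
      grind
    have h2 : ∀ h ∈ lines X L, ∑ A ∈ users X L h,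
        (h.card * (h.card - 1) : ℚ) / (users X L h).card =
        ((h ∩ X).card * (h ∩ X).card - (h ∩ X).card : ℕ) := by
      intro h hh
      obtain ⟨A, hA, hAh⟩ := mem_lines.mp hh
      have hpos : (0 : ℚ) < (users X L h).card := by exact_mod_cast users_pos hA hAh
      rw [Finset.inter_eq_left.mpr (hs.subset A hA h hAh), Nat.cast_sub (Nat.le_mul_self _),
        Finset.sum_const, nsmul_eq_mul]
      field_simp
      push_cast
      ring
    rw [h1, Finset.sum_congr rfl h2, ← Nat.cast_sum]
    have h3 := sum_offDiag_le hs.inter_le_one X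
    rw [hs.card_nodes] at h3
    rw [Finset.sum_const, hs.card_nodes]
    norm_num
    exact_mod_cast h3
  have heq := (Finset.sum_eq_sum_iff_of_le hle).mp
    (le_antisymm (Finset.sum_le_sum hle) htot)
  have hshare : ∀ A ∈ X,
      ∑ h ∈ L A, share ((L A).filter fun g => g.card = 5).card h.card = 20 := fun A hA =>
    le_antisymm ((Finset.sum_le_sum fun h hh => hs.share_le hno hA hh).trans (heq A hA).ge)
      (hs.le_sum_share hno hA).1
  have hfour : ∀ A ∈ X, ∀ h ∈ L A, h.card = 5 → (users X L h).card = 4 := by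
    intro A hA h hh hc
    have := (Finset.sum_eq_sum_iff_of_le fun h hh => hs.share_le hno hA hh).mp
      ((hshare A hA).trans (heq A hA)) h hh
    have hpos : (0 : ℚ) < (users X L h).card := by exact_mod_cast users_pos hA hh
    rw [eq_div_iff hpos.ne'] at this
    norm_num [share, hc] at this
    have : ((users X L h).card : ℚ) = 4 := by linarith
    exact_mod_cast this
  have h1 : ∑ A ∈ X, ∑ h ∈ L A, (if h.card = 5 then 1 else 0 : ℕ) = 42 := by
    rw [Finset.sum_congr rfl fun A hA =>
      (Finset.card_filter _ _).symm.trans ((hs.le_sum_share hno hA).2 (hshare A hA))]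
    simp [hs.card_nodes]
  have h2 : ∑ A ∈ X, ∑ h ∈ L A, (if h.card = 5 then 1 else 0 : ℕ) =
      ∑ h ∈ lines X L, ∑ A ∈ users X L h, (if h.card = 5 then 1 else 0 : ℕ) := by
    apply Finset.sum_comm'
    intro A h
    simp only [mem_lines, mem_users]
    grind
  have h3 : 4 ∣ ∑ h ∈ lines X L, ∑ A ∈ users X L h, (if h.card = 5 then 1 else 0 : ℕ) := by
    refine Finset.dvd_sum fun h hh => ?_
    obtain ⟨A, hA, hAh⟩ := mem_lines.mp hh
    split_ifs with hc
    · simp [hfour A hA h hAh hc]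
    · simp
  omega

variable {t t' : Fin 3 → Finset P} (ht : IsTriple X L t)

lemma subset_of_mem_lines {h : Finset P} (hh : h ∈ lines X L) : h ⊆ X := by
  obtain ⟨A, hA, hAh⟩ := mem_lines.mp hh
  exact hs.subset A hA h hAh

include ht

omit hs in
lemma triple_injective : Function.Injective t := by
  intro i j hij
  by_contra hne
  have h1 := ht.disj i j hne
  rw [hij, disjoint_self] at h1
  have h2 := ht.card j
  rw [h1] at h2
  simp at h2

omit hs in
lemma card_biUnion_triple : (Finset.univ.biUnion t).card = 15 := by
  rw [Finset.card_biUnion fun i _ j _ hij => ht.disj i j hij]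
  simp [ht.card]

lemma card_rest : (rest X t).card = 6 :=
  card_rest_of_card_eq hs.card_nodes ht fun i => hs.subset_of_mem_lines (ht.mem i)

lemma users_triple (i : Fin 3) : users X L (t i) = rest X t := by
  symm
  apply Finset.eq_of_subset_of_card_le
  · intro A hA
    exact mem_users.mpr ⟨(mem_rest.mp hA).1, hs.triple_mem t ht A hA i⟩
  · rw [hs.card_rest ht]
    obtain ⟨A, hA, hAt⟩ := mem_lines.mp (ht.mem i)
    exact hs.users_five_le A hA (t i) hAt (ht.card i)

lemma ne_triple {B : P} (hB : B ∈ X) (hBt : B ∉ rest X t) {h : Finset P} (hh : h ∈ L B)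
    (i : Fin 3) : h ≠ t i := by
  rintro rfl
  exact hBt (hs.users_triple ht i ▸ mem_users.mpr ⟨hB, hh⟩)

lemma card_inter_biUnion_le {h : Finset P} (hh : h ∈ lines X L) (hne : ∀ i, h ≠ t i) :
    (h ∩ Finset.univ.biUnion t).card ≤ 3 := by
  rw [Finset.inter_biUnion]
  refine Finset.card_biUnion_le.trans ?_
  have := Finset.sum_le_sum fun i (_ : i ∈ Finset.univ) =>
    hs.inter_le_one h hh (t i) (ht.mem i) (hne i)
  simpa using this

omit hs ht in
lemma inter_biUnion_eq {h : Finset P} (hh : h ⊆ X) :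
    h ∩ Finset.univ.biUnion t = h \ rest X t := by
  ext A
  simp only [rest, Finset.mem_inter, Finset.mem_sdiff]
  have := @hh A
  tauto

lemma card_sdiff_rest_le {h : Finset P} (hh : h ∈ lines X L) (hne : ∀ i, h ≠ t i) :
    (h \ rest X t).card ≤ 3 := by
  rw [← inter_biUnion_eq (hs.subset_of_mem_lines hh)]
  exact hs.card_inter_biUnion_le ht hh hne

omit hs ht in
lemma triple_inter_rest (i : Fin 3) : t i ∩ rest X t = ∅ := by
  ext A
  simp only [Finset.mem_inter, mem_rest, Finset.notMem_empty, iff_false]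
  exact fun h => h.2.2 i h.1

/-- Apart from the lines of the triple, a node of `rest X t` uses two lines. -/
lemma exists_pair {A : P} (hA : A ∈ rest X t) :
    ∃ m ∈ L A, ∃ m' ∈ L A, m ≠ m' ∧ (∀ h ∈ L A, (∀ i, h ≠ t i) → h = m ∨ h = m') ∧
      (∀ i, m ≠ t i) ∧ (∀ i, m' ≠ t i) ∧ (rest X t).erase A ⊆ m ∪ m' := by
  have hAX := (mem_rest.mp hA).1
  have hsub : Finset.univ.image t ⊆ L A := by
    intro h
    simp only [Finset.mem_image, Finset.mem_univ, true_and]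
    rintro ⟨i, rfl⟩
    exact hs.triple_mem t ht A hA i
  have hcard : (L A \ Finset.univ.image t).card = 2 := by
    rw [Finset.card_sdiff_of_subset hsub, hs.card_lines A hAX,
      Finset.card_image_of_injective _ (triple_injective ht)]
    simp
  obtain ⟨m, m', hne, heq⟩ := Finset.card_eq_two.mp hcard
  have hiff : ∀ h, (h ∈ L A ∧ ∀ i, h ≠ t i) ↔ (h = m ∨ h = m') := by
    intro h
    have : h ∈ L A \ Finset.univ.image t ↔ h ∈ ({m, m'} : Finset (Finset P)) := by rw [heq]
    simpa [eq_comm] using this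
  have hm := (hiff m).mpr (Or.inl rfl)
  have hm' := (hiff m').mpr (Or.inr rfl)
  refine ⟨m, hm.1, m', hm'.1, hne, fun h h1 h2 => (hiff h).mp ⟨h1, h2⟩, hm.2, hm'.2, ?_⟩
  intro C hC
  rw [Finset.mem_erase, mem_rest] at hC
  obtain ⟨h, hh, hCh⟩ := hs.cover A hAX C hC.2.1 hC.1
  have hht : ∀ i, h ≠ t i := by
    rintro i rfl
    exact hC.2.2 i hCh
  rcases (hiff h).mp ⟨hh, hht⟩ with rfl | rfl <;> simp [hCh]

lemma exists_other {A : P} (hA : A ∈ rest X t) {h : Finset P} (hh : h ∈ L A)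
    (hne : ∀ i, h ≠ t i) : ∃ n ∈ L A, (rest X t).erase A ⊆ h ∪ n := by
  obtain ⟨m, hm, m', hm', -, hall, -, -, hsub⟩ := hs.exists_pair ht hA
  rcases hall h hh hne with rfl | rfl
  · exact ⟨m', hm', hsub⟩
  · exact ⟨m, hm, by rwa [Finset.union_comm]⟩

lemma card_pair {A : P} (hA : A ∈ rest X t) {m m' : Finset P}
    (hsub : (rest X t).erase A ⊆ m ∪ m') :
    5 ≤ (m ∩ rest X t).card + (m' ∩ rest X t).card := by
  refine le_trans ?_ (Finset.card_union_le _ _)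
  have h1 := Finset.card_erase_of_mem hA
  rw [hs.card_rest ht] at h1
  rw [← show _ = 5 from h1]
  apply Finset.card_le_card
  intro C hC
  have := hsub hC
  simp only [Finset.mem_erase, Finset.mem_union, Finset.mem_inter] at *
  tauto

lemma exists_three {A : P} (hA : A ∈ rest X t) :
    ∃ m ∈ L A, (m ∩ rest X t).card = 3 := by
  have hAX := (mem_rest.mp hA).1
  obtain ⟨m, hm, m', hm', -, -, -, -, hsub⟩ := hs.exists_pair ht hA
  have h1 := hs.card_pair ht hA hsub
  have h2 := hs.inter_rest t ht m (mem_lines.mpr ⟨A, hAX, hm⟩)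
  have h3 := hs.inter_rest t ht m' (mem_lines.mpr ⟨A, hAX, hm'⟩)
  by_cases h : (m ∩ rest X t).card = 3
  · exact ⟨m, hm, h⟩
  · exact ⟨m', hm', by omega⟩

omit hs ht in
variable (X L t) in
/-- The lines with three nodes outside the triple. -/
def threeLines : Finset (Finset P) := (lines X L).filter fun h => (h ∩ rest X t).card = 3

omit hs ht in
variable (X L t) in
/-- The lines with two nodes outside the triple that are used by a node outside the triple. -/
def usedTwoLines : Finset (Finset P) :=
  (lines X L).filter fun h => (h ∩ rest X t).card = 2 ∧ (users X L h ∩ rest X t).Nonempty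

omit hs ht in
variable (X L t) in
/-- The lines with two nodes outside the triple that are not used by a node outside the triple. -/
def unusedTwoLines : Finset (Finset P) :=
  (lines X L).filter fun h => (h ∩ rest X t).card = 2 ∧ ¬ (users X L h ∩ rest X t).Nonempty

lemma users_of_three {h : Finset P} (hh : h ∈ lines X L) (h3 : (h ∩ rest X t).card = 3) :
    (users X L h ∩ rest X t).card = 3 := by
  have : users X L h ∩ rest X t = rest X t \ h := by
    ext A
    simp only [Finset.mem_inter, mem_users, Finset.mem_sdiff]
    constructor
    · rintro ⟨⟨h1, h2⟩, h4⟩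
      exact ⟨h4, hs.notMem A h1 h h2⟩
    · rintro ⟨h1, h2⟩
      exact ⟨⟨(mem_rest.mp h1).1, hs.mem_of_three t ht h hh h3 A h1 h2⟩, h1⟩
  rw [this, Finset.card_sdiff, h3, hs.card_rest ht]

lemma users_of_two {h : Finset P} (hh : h ∈ lines X L) (h2 : (h ∩ rest X t).card = 2) :
    (users X L h ∩ rest X t).card ≤ 1 := by
  rw [Finset.card_le_one]
  by_contra! hcon
  obtain ⟨A, hA, A', hA', hne⟩ := hcon
  simp only [Finset.mem_inter, mem_users] at hA hA'
  have hnt : ∀ i, h ≠ t i := by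
    rintro i rfl
    rw [triple_inter_rest] at h2
    simp at h2
  obtain ⟨n, hn, hsub⟩ := hs.exists_other ht hA.2 hA.1.2 hnt
  obtain ⟨n', hn', hsub'⟩ := hs.exists_other ht hA'.2 hA'.1.2 hnt
  have hAh := hs.notMem A hA.1.1 h hA.1.2
  have hAh' := hs.notMem A' hA'.1.1 h hA'.1.2
  have hcard : 1 < (((rest X t \ h).erase A).erase A').card := by
    rw [Finset.card_erase_of_mem (by simp [hne.symm, hA'.2, hAh']),
      Finset.card_erase_of_mem (by simp [hA.2, hAh]), Finset.card_sdiff, h2, hs.card_rest ht]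
    norm_num
  obtain ⟨a, ha, b, hb, hab⟩ := Finset.one_lt_card.mp hcard
  simp only [Finset.mem_erase, Finset.mem_sdiff] at ha hb
  have key : ∀ c, c ≠ A → c ∈ rest X t → c ∉ h → c ∈ n := by
    intro c h1 h2 h3
    have := hsub (Finset.mem_erase.mpr ⟨h1, h2⟩)
    simpa [h3] using this
  have key' : ∀ c, c ≠ A' → c ∈ rest X t → c ∉ h → c ∈ n' := by
    intro c h1 h2 h3
    have := hsub' (Finset.mem_erase.mpr ⟨h1, h2⟩)
    simpa [h3] using this
  have : n = n' := hs.eq_of_two (mem_lines.mpr ⟨A, hA.1.1, hn⟩) (mem_lines.mpr ⟨A', hA'.1.1, hn'⟩)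
    hab (key a ha.2.1 ha.2.2.1 ha.2.2.2) (key b hb.2.1 hb.2.2.1 hb.2.2.2)
    (key' a ha.1 ha.2.2.1 ha.2.2.2) (key' b hb.1 hb.2.2.1 hb.2.2.2)
  subst this
  exact hs.notMem A' hA'.1.1 n hn' (key A' hne.symm hA'.2 hAh')

lemma three_le_card_threeLines : 3 ≤ (threeLines X L t).card := by
  have hne : (rest X t).Nonempty := by
    rw [← Finset.card_pos, hs.card_rest ht]
    norm_num
  obtain ⟨A₀, hA₀⟩ := hne
  obtain ⟨m₀, hm₀, hm₀3⟩ := hs.exists_three ht hA₀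
  have hl : ∀ {A m}, A ∈ rest X t → m ∈ L A → m ∈ lines X L := fun h1 h2 =>
    mem_lines.mpr ⟨_, (mem_rest.mp h1).1, h2⟩
  obtain ⟨A₁, hA₁⟩ : (m₀ ∩ rest X t).Nonempty := by
    rw [← Finset.card_pos, hm₀3]
    norm_num
  rw [Finset.mem_inter] at hA₁
  obtain ⟨m₁, hm₁, hm₁3⟩ := hs.exists_three ht hA₁.2
  have hne1 : m₀ ≠ m₁ := by
    rintro rfl
    exact hs.notMem A₁ (mem_rest.mp hA₁.2).1 _ hm₁ hA₁.1
  obtain ⟨A₂, hA₂⟩ : ((m₀ ∩ rest X t) ∩ (m₁ ∩ rest X t)).Nonempty := by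
    by_contra hemp
    rw [Finset.not_nonempty_iff_eq_empty, ← Finset.disjoint_iff_inter_eq_empty] at hemp
    apply hs.not_cover t ht m₀ (hl hA₀ hm₀) m₁ (hl hA₁.2 hm₁)
    have h1 := Finset.card_union_of_disjoint hemp
    rw [← Finset.union_inter_distrib_right, hm₀3, hm₁3] at h1
    have h2 := Finset.eq_of_subset_of_card_le (s := (m₀ ∪ m₁) ∩ rest X t) (t := rest X t)
      Finset.inter_subset_right (by rw [h1, hs.card_rest ht])
    rw [← h2]
    exact Finset.inter_subset_left
  simp only [Finset.mem_inter] at hA₂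
  obtain ⟨m₂, hm₂, hm₂3⟩ := hs.exists_three ht hA₂.1.2
  have hn := hs.notMem A₂ (mem_rest.mp hA₂.1.2).1 _ hm₂
  have hne02 : m₀ ≠ m₂ := by rintro rfl; exact hn hA₂.1.1
  have hne12 : m₁ ≠ m₂ := by rintro rfl; exact hn hA₂.2.1
  rw [← Finset.card_eq_three.mpr ⟨m₀, m₁, m₂, hne1, hne02, hne12, rfl⟩]
  apply Finset.card_le_card
  intro m
  simp only [Finset.mem_insert, Finset.mem_singleton, threeLines, Finset.mem_filter]
  rintro (rfl | rfl | rfl)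
  exacts [⟨hl hA₀ hm₀, hm₀3⟩, ⟨hl hA₁.2 hm₁, hm₁3⟩, ⟨hl hA₂.1.2 hm₂, hm₂3⟩]

lemma twelve_le_card : 12 ≤ 3 * (threeLines X L t).card + (usedTwoLines X L t).card := by
  have h1 : ∀ A ∈ rest X t, (2 : ℤ) ≤
      ∑ h ∈ L A, if 2 ≤ (h ∩ rest X t).card then 1 else 0 := by
    intro A hA
    have hAX := (mem_rest.mp hA).1
    obtain ⟨m, hm, m', hm', hne, -, -, -, hsub⟩ := hs.exists_pair ht hA
    have h1 := hs.card_pair ht hA hsub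
    have h2 := hs.inter_rest t ht m (mem_lines.mpr ⟨A, hAX, hm⟩)
    have h3 := hs.inter_rest t ht m' (mem_lines.mpr ⟨A, hAX, hm'⟩)
    rw [← Finset.natCast_card_filter]
    norm_cast
    refine (Finset.card_pair hne).ge.trans (Finset.card_le_card ?_)
    intro h
    simp only [Finset.mem_insert, Finset.mem_singleton, Finset.mem_filter]
    rintro (rfl | rfl)
    · exact ⟨hm, by omega⟩
    · exact ⟨hm', by omega⟩
  have h2 := Finset.sum_le_sum h1
  rw [sum_users (fun A hA => (mem_rest.mp hA).1)
    (fun _ h => if 2 ≤ (h ∩ rest X t).card then 1 else 0), Finset.sum_const, hs.card_rest ht] at h2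
  have h3 : ∀ h ∈ lines X L,
      ∑ A ∈ users X L h ∩ rest X t, (if 2 ≤ (h ∩ rest X t).card then (1 : ℤ) else 0) ≤
      3 * (if (h ∩ rest X t).card = 3 then 1 else 0) +
        (if (h ∩ rest X t).card = 2 ∧ (users X L h ∩ rest X t).Nonempty then 1 else 0) := by
    intro h hh
    rw [Finset.sum_const, nsmul_eq_mul]
    have hle := hs.inter_rest t ht h hh
    by_cases hc3 : (h ∩ rest X t).card = 3
    · simp [hc3, hs.users_of_three ht hh hc3]
    by_cases hc2 : (h ∩ rest X t).card = 2
    · have := hs.users_of_two ht hh hc2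
      by_cases hemp : (users X L h ∩ rest X t).Nonempty
      · simp [hc2, hemp]
        exact_mod_cast this
      · rw [Finset.not_nonempty_iff_eq_empty] at hemp
        simp [hc2, hemp]
    · rw [if_neg (by omega)]
      simp [hc2, hc3]
  have h4 := h2.trans (Finset.sum_le_sum h3)
  rw [Finset.sum_add_distrib, ← Finset.mul_sum, ← Finset.natCast_card_filter,
    ← Finset.natCast_card_filter] at h4
  norm_num at h4
  exact_mod_cast h4

lemma card_le_fifteen : 3 * (threeLines X L t).card + (usedTwoLines X L t).card +
    (unusedTwoLines X L t).card ≤ 15 := by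
  have h1 := sum_offDiag_le hs.inter_le_one (rest X t)
  rw [hs.card_rest ht] at h1
  have h2 : ∀ h ∈ lines X L, 6 * (if (h ∩ rest X t).card = 3 then 1 else 0) +
      2 * (if (h ∩ rest X t).card = 2 ∧ (users X L h ∩ rest X t).Nonempty then 1 else 0) +
      2 * (if (h ∩ rest X t).card = 2 ∧ ¬ (users X L h ∩ rest X t).Nonempty then 1 else 0) ≤
      (h ∩ rest X t).card * (h ∩ rest X t).card - (h ∩ rest X t).card := by
    intro h hh
    by_cases hc3 : (h ∩ rest X t).card = 3
    · simp [hc3]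
    by_cases hc2 : (h ∩ rest X t).card = 2
    · by_cases hemp : (users X L h ∩ rest X t).Nonempty <;> simp [hc2, hemp]
    · simp [hc2, hc3]
  have h3 := (Finset.sum_le_sum h2).trans h1
  rw [Finset.sum_add_distrib, Finset.sum_add_distrib, ← Finset.mul_sum, ← Finset.mul_sum,
    ← Finset.mul_sum, ← Finset.card_filter, ← Finset.card_filter, ← Finset.card_filter] at h3
  simp only [threeLines, usedTwoLines, unusedTwoLines]
  omega

lemma card_unusedTwoLines_le : (unusedTwoLines X L t).card ≤ 3 := by
  have := hs.twelve_le_card ht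
  have := hs.card_le_fifteen ht
  omega

lemma card_usedTwoLines_add_le :
    (usedTwoLines X L t).card + (unusedTwoLines X L t).card ≤ 6 := by
  have := hs.three_le_card_threeLines ht
  have := hs.card_le_fifteen ht
  omega

lemma six_le_sum {B : P} (hB : B ∈ X) (hBt : B ∉ rest X t) :
    6 ≤ ∑ h ∈ L B, (h ∩ rest X t).card := by
  rw [← hs.card_rest ht]
  exact hs.card_le_sum hB Finset.sdiff_subset hBt

lemma fourteen_le_sum {B : P} (hB : B ∈ X) (hBt : B ∉ rest X t) :
    14 ≤ ∑ h ∈ L B, (h \ rest X t).card := by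
  have hsub : Finset.univ.biUnion t ⊆ X := by
    simpa using fun i => hs.subset_of_mem_lines (ht.mem i)
  have hmem : B ∈ Finset.univ.biUnion t := by
    simp only [rest, Finset.mem_sdiff, hB, true_and, not_not] at hBt
    exact hBt
  have h1 := hs.card_le_sum hB ((Finset.erase_subset B _).trans hsub) (Finset.notMem_erase B _)
  rw [Finset.card_erase_of_mem hmem, card_biUnion_triple ht] at h1
  refine h1.trans (Finset.sum_le_sum fun h hh => ?_)
  rw [← inter_biUnion_eq (hs.subset B hB h hh)]
  exact Finset.card_le_card (Finset.inter_subset_inter_left (Finset.erase_subset B _))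

lemma two_le_sdiff {B : P} (hB : B ∈ X) (hBt : B ∉ rest X t) {h : Finset P} (hh : h ∈ L B) :
    2 ≤ (h \ rest X t).card := by
  have h1 := hs.fourteen_le_sum ht hB hBt
  rw [← Finset.add_sum_erase _ _ hh] at h1
  have h2 : ∑ g ∈ (L B).erase h, (g \ rest X t).card ≤ ∑ g ∈ (L B).erase h, 3 :=
    Finset.sum_le_sum fun g hg => by
      have hg' := Finset.mem_of_mem_erase hg
      exact hs.card_sdiff_rest_le ht (mem_lines.mpr ⟨B, hB, hg'⟩) (hs.ne_triple ht hB hBt hg')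
  rw [Finset.sum_const, Finset.card_erase_of_mem hh, hs.card_lines B hB] at h2
  simp at h2
  omega

omit hs ht in
lemma card_inter_add_card_sdiff_rest (h : Finset P) :
    (h ∩ rest X t).card + (h \ rest X t).card = h.card :=
  Finset.card_inter_add_card_sdiff h _

section TwoTriples

variable (ht' : IsTriple X L t') (hne : rest X t ≠ rest X t')
include ht' hne

lemma triple_ne_triple (i j : Fin 3) : t i ≠ t' j := fun h =>
  hne (by rw [← hs.users_triple ht i, ← hs.users_triple ht' j, h])

lemma disjoint_rest : Disjoint (rest X t) (rest X t') := by
  rw [Finset.disjoint_left]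
  intro A hA hA'
  have hd : Disjoint (Finset.univ.image t) (Finset.univ.image t') := by
    rw [Finset.disjoint_left]
    simp only [Finset.mem_image, Finset.mem_univ, true_and]
    rintro _ ⟨i, rfl⟩ ⟨j, hj⟩
    exact hs.triple_ne_triple ht ht' hne i j hj.symm
  have h1 := Finset.card_union_of_disjoint hd
  rw [Finset.card_image_of_injective _ (triple_injective ht),
    Finset.card_image_of_injective _ (triple_injective ht')] at h1
  have h2 : Finset.univ.image t ∪ Finset.univ.image t' ⊆ L A := by
    intro h
    simp only [Finset.mem_union, Finset.mem_image, Finset.mem_univ, true_and]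
    rintro (⟨i, rfl⟩ | ⟨i, rfl⟩)
    exacts [hs.triple_mem t ht A hA i, hs.triple_mem t' ht' A hA' i]
  have h3 := Finset.card_le_card h2
  rw [h1, hs.card_lines A (mem_rest.mp hA).1] at h3
  simp at h3

lemma unusedTwoLines_eq : unusedTwoLines X L t = Finset.univ.image t' := by
  symm
  apply Finset.eq_of_subset_of_card_le
  · intro h
    simp only [Finset.mem_image, Finset.mem_univ, true_and]
    rintro ⟨j, rfl⟩
    have hge : ∀ j, 2 ≤ (t' j ∩ rest X t).card := by
      intro j
      have h1 := hs.card_sdiff_rest_le ht (ht'.mem j) fun i h =>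
        hs.triple_ne_triple ht ht' hne i j h.symm
      have h2 := card_inter_add_card_sdiff_rest (X := X) (t := t) (t' j)
      rw [ht'.card j] at h2
      omega
    have hle : ∑ j, (t' j ∩ rest X t).card ≤ 6 := by
      rw [← Finset.card_biUnion fun i _ j _ hij => (ht'.disj i j hij).mono
        Finset.inter_subset_left Finset.inter_subset_left, ← hs.card_rest ht]
      apply Finset.card_le_card
      simp
    have h2 : (t' j ∩ rest X t).card = 2 := by
      have := (Finset.sum_eq_sum_iff_of_le fun j (_ : j ∈ Finset.univ) => hge j).mp
        (le_antisymm (Finset.sum_le_sum fun j _ => hge j) (by simpa using hle)) j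
        (Finset.mem_univ j)
      exact this.symm
    simp only [unusedTwoLines, Finset.mem_filter, ht'.mem j, h2, true_and,
      hs.users_triple ht' j, Finset.not_nonempty_iff_eq_empty]
    rw [← Finset.disjoint_iff_inter_eq_empty]
    exact (hs.disjoint_rest ht ht' hne).symm
  · rw [Finset.card_image_of_injective _ (triple_injective ht')]
    simpa using hs.card_unusedTwoLines_le ht

lemma card_usedTwoLines_le : (usedTwoLines X L t).card ≤ 3 := by
  have h1 := hs.card_usedTwoLines_add_le ht
  rw [hs.unusedTwoLines_eq ht ht' hne,
    Finset.card_image_of_injective _ (triple_injective ht')] at h1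
  simp at h1
  omega

lemma not_mem_rest_of_notMem {w : P} (hw : w ∉ rest X t) (hw' : w ∉ rest X t')
    {t'' : Fin 3 → Finset P} (ht'' : IsTriple X L t'') : w ∉ rest X t'' := by
  intro hw''
  have h1 : t'' 0 ∈ unusedTwoLines X L t := by
    rw [hs.unusedTwoLines_eq ht ht'' (by rintro h; exact hw (h ▸ hw''))]
    simp
  rw [hs.unusedTwoLines_eq ht ht' hne] at h1
  simp only [Finset.mem_image, Finset.mem_univ, true_and] at h1
  obtain ⟨j, hj⟩ := h1
  apply hw'
  rw [← hs.users_triple ht' j, hj, hs.users_triple ht'' 0]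
  exact hw''

lemma users_rest_nonempty {h : Finset P} (hh : h ∈ lines X L) (hnt : ∀ j, h ≠ t' j)
    (h2 : 2 ≤ (h ∩ rest X t).card) : (users X L h ∩ rest X t).Nonempty := by
  have h3 := hs.inter_rest t ht h hh
  by_cases hc3 : (h ∩ rest X t).card = 3
  · rw [← Finset.card_pos, hs.users_of_three ht hh hc3]
    norm_num
  · by_contra hemp
    have : h ∈ unusedTwoLines X L t := by
      simp only [unusedTwoLines, Finset.mem_filter]
      exact ⟨hh, by omega, hemp⟩
    rw [hs.unusedTwoLines_eq ht ht' hne] at this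
    simp only [Finset.mem_image, Finset.mem_univ, true_and] at this
    obtain ⟨j, hj⟩ := this
    exact hnt j hj.symm

/-- Behaviour of a line used by a node outside both six-node sets. -/
lemma users_outer_le {w : P} (hwX : w ∈ X) (hw : w ∉ rest X t) (hw' : w ∉ rest X t')
    {h : Finset P} (hh : h ∈ L w) (h2 : 2 ≤ (h ∩ rest X t).card) :
    h ∈ usedTwoLines X L t ∧ (users X L h ∩ (X \ (rest X t ∪ rest X t'))).card ≤ 2 := by
  have hl : h ∈ lines X L := mem_lines.mpr ⟨w, hwX, hh⟩
  have hnt := hs.ne_triple ht hwX hw hh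
  have hnt' := hs.ne_triple ht' hwX hw' hh
  have hd := hs.disjoint_rest ht ht' hne
  have hne1 := hs.users_rest_nonempty ht ht' hne hl hnt' h2
  have hx3 := hs.inter_rest t ht h hl
  have hb := hs.two_le_sdiff ht hwX hw hh
  have hadd := card_inter_add_card_sdiff_rest (X := X) (t := t) h
  have h5 := hs.le_five w hwX h hh
  have husers : (users X L h ∩ rest X t).card + (users X L h ∩ rest X t').card +
      (users X L h ∩ (X \ (rest X t ∪ rest X t'))).card ≤ (users X L h).card := by
    rw [← Finset.card_union_of_disjoint (hd.mono Finset.inter_subset_right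
      Finset.inter_subset_right), ← Finset.inter_union_distrib_left,
      ← Finset.card_union_of_disjoint]
    · exact Finset.card_le_card (Finset.union_subset Finset.inter_subset_left
        Finset.inter_subset_left)
    · exact Finset.disjoint_sdiff.mono Finset.inter_subset_right Finset.inter_subset_right
  have hw1 : 1 ≤ (users X L h ∩ (X \ (rest X t ∪ rest X t'))).card :=
    Finset.card_pos.mpr ⟨w, by simp [mem_users, hwX, hh, hw, hw']⟩
  have hfive : h.card = 5 → (users X L h).card ≤ 4 ∧ 1 ≤ (users X L h ∩ rest X t').card := by
    intro hc
    constructor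
    · by_contra! hlt
      obtain ⟨t'', ht'', hwt⟩ := hs.users_five w hwX h hh hc hlt
      exact hs.not_mem_rest_of_notMem ht ht' hne hw hw' ht'' hwt
    · apply Finset.card_pos.mpr
      apply hs.users_rest_nonempty ht' ht hne.symm hl hnt
      have h3 := hs.card_sdiff_rest_le ht' hl hnt'
      have h4 := card_inter_add_card_sdiff_rest (X := X) (t := t') h
      omega
  have hpos := Finset.card_pos.mpr hne1
  by_cases hc3 : (h ∩ rest X t).card = 3
  · have := hs.users_of_three ht hl hc3
    have := hfive (by omega)
    omega
  · have hc2 : (h ∩ rest X t).card = 2 := by omega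
    refine ⟨by simp [usedTwoLines, hl, hc2, hne1], ?_⟩
    by_cases hc : h.card = 5
    · have := hfive hc
      omega
    · have := hs.users_four w hwX h hh (by omega)
      omega

lemma false_of_two_triples : False := by
  have hd := hs.disjoint_rest ht ht' hne
  set W := X \ (rest X t ∪ rest X t') with hW
  have hWX : W ⊆ X := Finset.sdiff_subset
  have hcard : W.card = 9 := by
    rw [hW, Finset.card_sdiff_of_subset, Finset.card_union_of_disjoint hd, hs.card_rest ht,
      hs.card_rest ht', hs.card_nodes]
    exact Finset.union_subset Finset.sdiff_subset Finset.sdiff_subset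
  have hmem : ∀ w ∈ W, w ∈ X ∧ w ∉ rest X t ∧ w ∉ rest X t' := by
    intro w hw
    simpa [hW] using hw
  have h1 : ∀ w ∈ W, (1 : ℤ) ≤ ∑ h ∈ L w, if h ∈ usedTwoLines X L t then 1 else 0 := by
    intro w hw
    obtain ⟨hwX, hwt, hwt'⟩ := hmem w hw
    rw [← Finset.natCast_card_filter]
    norm_cast
    apply Finset.card_pos.mpr
    by_contra hemp
    have h2 : ∑ h ∈ L w, (h ∩ rest X t).card ≤ ∑ h ∈ L w, 1 := by
      refine Finset.sum_le_sum fun h hh => ?_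
      by_contra! hlt
      exact hemp ⟨h, Finset.mem_filter.mpr
        ⟨hh, (hs.users_outer_le ht ht' hne hwX hwt hwt' hh hlt).1⟩⟩
    have h3 := hs.six_le_sum ht hwX hwt
    rw [Finset.sum_const, hs.card_lines w hwX] at h2
    simp at h2
    omega
  have h2 := Finset.sum_le_sum h1
  rw [sum_users hWX (fun _ h => if h ∈ usedTwoLines X L t then 1 else 0), Finset.sum_const,
    hcard] at h2
  have h3 : ∀ h ∈ lines X L, ∑ A ∈ users X L h ∩ W,
      (if h ∈ usedTwoLines X L t then (1 : ℤ) else 0) ≤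
      2 * if h ∈ usedTwoLines X L t then 1 else 0 := by
    intro h hh
    split_ifs with hE
    · by_cases hemp : (users X L h ∩ W).Nonempty
      · obtain ⟨w, hw⟩ := hemp
        rw [Finset.mem_inter, mem_users] at hw
        obtain ⟨hwX, hwt, hwt'⟩ := hmem w hw.2
        simp only [usedTwoLines, Finset.mem_filter] at hE
        have := (hs.users_outer_le ht ht' hne hwX hwt hwt' hw.1.2 hE.2.1.ge).2
        simp
        exact_mod_cast this
      · rw [Finset.not_nonempty_iff_eq_empty] at hemp
        simp [hemp]
    · simp
  have h4 := h2.trans (Finset.sum_le_sum h3)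
  rw [← Finset.mul_sum, ← Finset.natCast_card_filter, Finset.filter_mem_eq_inter] at h4
  have h5 := hs.card_usedTwoLines_le ht ht' hne
  have h6 : (lines X L ∩ usedTwoLines X L t).card ≤ (usedTwoLines X L t).card :=
    Finset.card_le_card Finset.inter_subset_right
  norm_num at h4
  norm_cast at h4
  omega

end TwoTriples

section OneTriple

variable (hall : ∀ s, IsTriple X L s → rest X s = rest X t)
include hall

omit ht in
lemma card_users_le {B : P} (hB : B ∈ X) (hBt : B ∉ rest X t) {h : Finset P} (hh : h ∈ L B) :
    (h.card = 3 → (users X L h).card ≤ 2) ∧ (h.card = 5 → (users X L h).card ≤ 4) := by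
  constructor
  · intro hc
    by_contra! hlt
    obtain ⟨s, hs1, hs2⟩ := hs.users_three B hB h hh hc hlt
    exact hBt (hall s hs1 ▸ hs2)
  · intro hc
    by_contra! hlt
    obtain ⟨s, hs1, hs2⟩ := hs.users_five B hB h hh hc hlt
    exact hBt (hall s hs1 ▸ hs2)

omit hs ht hall in
variable (X L t) in
/-- The weight of a line used by a node on the triple. -/
def weight (B : P) (h : Finset P) : ℤ :=
  2 * (h ∩ rest X t).card + 2 * (if h.card = 5 then 1 else 0) +
    if (h ∩ rest X t).card = 1 ∧ (h \ rest X t).card = 3 ∧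
      ((L B).filter fun g => g.card = 5).card ≤ 1 then 1 else 0

omit hall in
lemma sixteen_le_sum_weight {B : P} (hB : B ∈ X) (hBt : B ∉ rest X t) :
    16 ≤ ∑ h ∈ L B, weight X L t B h := by
  have h6 := hs.six_le_sum ht hB hBt
  have h14 := hs.fourteen_le_sum ht hB hBt
  zify at h6 h14
  by_cases hf : ((L B).filter fun g => g.card = 5).card ≤ 1
  · have hw : ∀ h ∈ L B, 3 * ((h ∩ rest X t).card : ℤ) + 2 * (h \ rest X t).card - 6 ≤
        weight X L t B h := by
      intro h hh
      have hl : h ∈ lines X L := mem_lines.mpr ⟨B, hB, hh⟩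
      have h1 := hs.inter_rest t ht h hl
      have h2 := hs.two_le_sdiff ht hB hBt hh
      have h3 := hs.card_sdiff_rest_le ht hl (hs.ne_triple ht hB hBt hh)
      have h4 := card_inter_add_card_sdiff_rest (X := X) (t := t) h
      have h5 := hs.le_five B hB h hh
      simp only [weight, hf, and_true]
      split_ifs <;> omega
    have := Finset.sum_le_sum hw
    rw [Finset.sum_sub_distrib, Finset.sum_add_distrib, ← Finset.mul_sum, ← Finset.mul_sum,
      Finset.sum_const, hs.card_lines B hB] at this
    norm_num at this
    linarith
  · have hw : ∀ h ∈ L B, 2 * ((h ∩ rest X t).card : ℤ) + 2 * (if h.card = 5 then 1 else 0) ≤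
        weight X L t B h := by
      intro h hh
      simp only [weight]
      split_ifs <;> omega
    have := Finset.sum_le_sum hw
    rw [Finset.sum_add_distrib, ← Finset.mul_sum, ← Finset.mul_sum,
      ← Finset.natCast_card_filter] at this
    have hf' : (2 : ℤ) ≤ ((L B).filter fun g => g.card = 5).card := by
      exact_mod_cast not_le.mp hf
    linarith

lemma sum_weight_le {h : Finset P} (hh : h ∈ lines X L) :
    ∑ B ∈ users X L h ∩ (X \ rest X t), weight X L t B h ≤
      2 * ((h ∩ rest X t).card * (h ∩ (X \ rest X t)).card : ℕ) +
      6 * (if h ∈ usedTwoLines X L t then 1 else 0) +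
      12 * (if h ∈ unusedTwoLines X L t then 1 else 0) := by
  obtain hemp | ⟨w, hw⟩ := (users X L h ∩ (X \ rest X t)).eq_empty_or_nonempty
  · rw [hemp, Finset.sum_empty]
    positivity
  rw [Finset.mem_inter, mem_users, Finset.mem_sdiff] at hw
  obtain ⟨⟨hwX, hwh⟩, -, hwt⟩ := hw
  have hsub := hs.subset w hwX h hwh
  have heq : h ∩ (X \ rest X t) = h \ rest X t := by
    rw [← Finset.inter_sdiff_assoc, Finset.inter_eq_left.mpr hsub]
  have h1 := hs.inter_rest t ht h hh
  have h2 := hs.two_le_sdiff ht hwX hwt hwh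
  have h3 := hs.card_sdiff_rest_le ht hh (hs.ne_triple ht hwX hwt hwh)
  have h4 := card_inter_add_card_sdiff_rest (X := X) (t := t) h
  have h5 := hs.le_five w hwX h hwh
  have hu4 := hs.users_four w hwX h hwh
  obtain ⟨hu3, hu5⟩ := hs.card_users_le hall hwX hwt hwh
  have hadd : (users X L h ∩ rest X t).card + (users X L h ∩ (X \ rest X t)).card =
      (users X L h).card := by
    rw [← Finset.card_inter_add_card_sdiff (users X L h) (rest X t), ← Finset.inter_sdiff_assoc,
      Finset.inter_eq_left.mpr (show users X L h ⊆ X from Finset.filter_subset _ _)]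
  have hle : ∀ B ∈ users X L h ∩ (X \ rest X t), weight X L t B h ≤
      2 * (h ∩ rest X t).card + 2 * (if h.card = 5 then 1 else 0) +
      if (h ∩ rest X t).card = 1 ∧ (h \ rest X t).card = 3 ∧ (users X L h).card ≤ 2
        then 1 else 0 := by
    intro B hB
    rw [Finset.mem_inter, mem_users, Finset.mem_sdiff] at hB
    have hg := hs.users_four_eq B hB.1.1 h hB.1.2
    simp only [weight]
    split_ifs <;> omega
  refine (Finset.sum_le_sum hle).trans ?_
  rw [Finset.sum_const, nsmul_eq_mul, heq]
  have ht3 := hs.users_of_three ht hh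
  have hE : h ∈ usedTwoLines X L t ↔
      (h ∩ rest X t).card = 2 ∧ 0 < (users X L h ∩ rest X t).card := by
    simp [usedTwoLines, hh, Finset.card_pos]
  have hD : h ∈ unusedTwoLines X L t ↔
      (h ∩ rest X t).card = 2 ∧ ¬ 0 < (users X L h ∩ rest X t).card := by
    simp [unusedTwoLines, hh, Finset.card_pos]
  rw [if_congr hE rfl rfl, if_congr hD rfl rfl]
  generalize (users X L h ∩ (X \ rest X t)).card = n at *
  generalize (users X L h ∩ rest X t).card = m at *
  generalize (users X L h).card = u at *
  generalize (h ∩ rest X t).card = x at *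
  generalize (h \ rest X t).card = b at *
  generalize h.card = k at *
  obtain rfl | rfl : b = 2 ∨ b = 3 := by omega
  all_goals
    obtain rfl | rfl | rfl | rfl : x = 0 ∨ x = 1 ∨ x = 2 ∨ x = 3 := by omega
    all_goals
      subst h4
      norm_num at *
    all_goals try split_ifs
    all_goals try omega

lemma false_of_one_triple : False := by
  have hcard : (X \ rest X t).card = 15 := by
    rw [Finset.card_sdiff_of_subset (show rest X t ⊆ X from Finset.sdiff_subset),
      hs.card_rest ht, hs.card_nodes]
  have h1 : ∀ B ∈ X \ rest X t, 16 ≤ ∑ h ∈ L B, weight X L t B h := by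
    intro B hB
    rw [Finset.mem_sdiff] at hB
    exact hs.sixteen_le_sum_weight ht hB.1 hB.2
  have h2 := Finset.sum_le_sum h1
  rw [sum_users Finset.sdiff_subset (weight X L t), Finset.sum_const, hcard] at h2
  have h3 := h2.trans (Finset.sum_le_sum fun h hh => hs.sum_weight_le ht hall hh)
  rw [Finset.sum_add_distrib, Finset.sum_add_distrib, ← Finset.mul_sum, ← Finset.mul_sum,
    ← Finset.mul_sum, ← Finset.natCast_card_filter, ← Finset.natCast_card_filter,
    Finset.filter_mem_eq_inter, Finset.filter_mem_eq_inter] at h3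
  have h4 := sum_mul_le hs.inter_le_one (S := rest X t) (T := X \ rest X t)
    Finset.disjoint_sdiff
  rw [hcard, hs.card_rest ht] at h4
  have h5 := hs.card_usedTwoLines_add_le ht
  have h6 := hs.card_unusedTwoLines_le ht
  have h7 := Finset.card_le_card
    (Finset.inter_subset_right : lines X L ∩ usedTwoLines X L t ⊆ _)
  have h8 := Finset.card_le_card
    (Finset.inter_subset_right : lines X L ∩ unusedTwoLines X L t ⊆ _)
  norm_num at h3
  norm_cast at h3
  omega

end OneTriple

omit ht in
theorem contradiction : False := by
  obtain ⟨t, ht⟩ := hs.exists_triple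
  by_cases hall : ∀ s, IsTriple X L s → rest X s = rest X t
  · exact hs.false_of_one_triple ht hall
  · push Not at hall
    obtain ⟨s, hs1, hs2⟩ := hall
    exact hs.false_of_two_triples ht hs1 hs2.symm

end LineSystem

end LineSystem

section PlanePolynomials

lemma ev_mul (p q : MvPolynomial (Fin 2) ℝ) (A : ℝ × ℝ) : ev (p * q) A = ev p A * ev q A := by
  simp [ev]

lemma ev_prod {ι : Type*} (s : Finset ι) (f : ι → MvPolynomial (Fin 2) ℝ) (A : ℝ × ℝ) :
    ev (∏ i ∈ s, f i) A = ∏ i ∈ s, ev (f i) A := by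
  simp [ev, map_prod]

lemma totalDegree_prod_le_card {ι : Type*} (s : Finset ι) (f : ι → MvPolynomial (Fin 2) ℝ)
    (hf : ∀ i ∈ s, (f i).totalDegree ≤ 1) : (∏ i ∈ s, f i).totalDegree ≤ s.card :=
  (totalDegree_finsetProd s f).trans (by simpa using Finset.sum_le_sum hf)

lemma totalDegree_mul_le_of_le {p q : MvPolynomial (Fin 2) ℝ} {m n : ℕ} (hp : p.totalDegree ≤ m)
    (hq : q.totalDegree ≤ n) : (p * q).totalDegree ≤ m + n :=
  (totalDegree_mul p q).trans (add_le_add hp hq)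

lemma exists_coeffs {l : MvPolynomial (Fin 2) ℝ} (hl : IsLinePoly l) :
    ∃ a b c : ℝ, (a ≠ 0 ∨ b ≠ 0) ∧ ∀ A, ev l A = a * A.1 + b * A.2 + c := by
  have hsub : l.support ⊆ {0, Finsupp.single 0 1, Finsupp.single 1 1} := by
    intro d hd
    have h1 : d.sum (fun _ e => e) ≤ 1 := hl ▸ le_totalDegree hd
    rw [Finsupp.sum_fintype _ _ (by simp), Fin.sum_univ_two] at h1
    have h2 : (d 0 = 0 ∧ d 1 = 0) ∨ (d 0 = 1 ∧ d 1 = 0) ∨ (d 0 = 0 ∧ d 1 = 1) := by omega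
    simp only [Finset.mem_insert, Finset.mem_singleton]
    rcases h2 with h2 | h2 | h2
    · left; ext i; fin_cases i <;> simp [h2]
    · right; left; ext i; fin_cases i <;> simp [h2]
    · right; right; ext i; fin_cases i <;> simp [h2]
  have h01 : (0 : Fin 2 →₀ ℕ) ≠ Finsupp.single 0 1 := by
    intro h; simpa using DFunLike.congr_fun h 0
  have h02 : (0 : Fin 2 →₀ ℕ) ≠ Finsupp.single 1 1 := by
    intro h; simpa using DFunLike.congr_fun h 1
  have h12 : (Finsupp.single 0 1 : Fin 2 →₀ ℕ) ≠ Finsupp.single 1 1 := by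
    intro h; simpa using DFunLike.congr_fun h 0
  have hl' : l = C (coeff 0 l) + C (coeff (Finsupp.single 0 1) l) * X 0 +
      C (coeff (Finsupp.single 1 1) l) * X 1 := by
    conv_lhs => rw [← support_sum_monomial_coeff l]
    rw [Finset.sum_subset hsub (by simp +contextual),
      Finset.sum_insert (by simp [h01, h02]), Finset.sum_insert (by simp [h12]),
      Finset.sum_singleton, C_mul_X_eq_monomial, C_mul_X_eq_monomial]
    simp [add_assoc]
  refine ⟨coeff (Finsupp.single 0 1) l, coeff (Finsupp.single 1 1) l, coeff 0 l, ?_, ?_⟩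
  · by_contra! hcon
    rw [hcon.1, hcon.2] at hl'
    have : l.totalDegree = 0 := by rw [hl']; simp
    rw [IsLinePoly] at hl
    omega
  · intro A
    conv_lhs => rw [hl']
    simp [ev]
    ring

lemma ev_eq_zero_iff {l l' : MvPolynomial (Fin 2) ℝ} (hl : IsLinePoly l) (hl' : IsLinePoly l')
    {P Q : ℝ × ℝ} (hPQ : P ≠ Q) (hP : ev l P = 0) (hQ : ev l Q = 0) (hP' : ev l' P = 0)
    (hQ' : ev l' Q = 0) (R : ℝ × ℝ) : ev l R = 0 ↔ ev l' R = 0 := by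
  suffices h : ∀ {l l' : MvPolynomial (Fin 2) ℝ}, IsLinePoly l → IsLinePoly l' →
      ev l P = 0 → ev l Q = 0 → ev l' P = 0 → ev l' Q = 0 → ev l R = 0 → ev l' R = 0 from
    ⟨h hl hl' hP hQ hP' hQ', h hl' hl hP' hQ' hP hQ⟩
  clear * - hPQ
  intro l l' hl hl' hP hQ hP' hQ' hR
  obtain ⟨a, b, c, hab, h⟩ := exists_coeffs hl
  obtain ⟨a', b', c', -, h'⟩ := exists_coeffs hl'
  rw [h] at hP hQ hR
  rw [h'] at hP' hQ' ⊢
  have h1 : a * (Q.1 - P.1) + b * (Q.2 - P.2) = 0 := by linear_combination hQ - hP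
  have h2 : a' * (Q.1 - P.1) + b' * (Q.2 - P.2) = 0 := by linear_combination hQ' - hP'
  have h3 : a * (R.1 - P.1) + b * (R.2 - P.2) = 0 := by linear_combination hR - hP
  have hdet : a * b' - a' * b = 0 := by
    have hx : (a * b' - a' * b) * (Q.1 - P.1) = 0 := by linear_combination b' * h1 - b * h2
    have hy : (a * b' - a' * b) * (Q.2 - P.2) = 0 := by linear_combination a * h2 - a' * h1
    by_contra hne
    apply hPQ
    ext
    · linarith [(mul_eq_zero.mp hx).resolve_left hne]
    · linarith [(mul_eq_zero.mp hy).resolve_left hne]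
  have h4 : a' * (R.1 - P.1) + b' * (R.2 - P.2) = 0 := by
    rcases hab with ha | hb
    · apply mul_left_cancel₀ ha
      linear_combination a' * h3 + (R.2 - P.2) * hdet
    · apply mul_left_cancel₀ hb
      linear_combination b' * h3 - (R.1 - P.1) * hdet
  linear_combination h4 + hP'

lemma exists_injective_zeros {l : MvPolynomial (Fin 2) ℝ} (hl : IsLinePoly l) :
    ∃ z : ℝ → ℝ × ℝ, Function.Injective z ∧ ∀ s, ev l (z s) = 0 := by
  obtain ⟨a, b, c, hab, h⟩ := exists_coeffs hl
  have hpos : a ^ 2 + b ^ 2 ≠ 0 := by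
    rcases hab with ha | hb <;> positivity
  refine ⟨fun s => (-(a * c) / (a ^ 2 + b ^ 2) + s * b, -(b * c) / (a ^ 2 + b ^ 2) - s * a),
    ?_, ?_⟩
  · intro s s' hss
    simp only [Prod.mk.injEq, add_right_inj, sub_right_inj] at hss
    rcases hab with ha | hb
    · exact mul_right_cancel₀ ha hss.2
    · exact mul_right_cancel₀ hb hss.1
  · intro s
    rw [h]
    field_simp
    ring

lemma exists_separating {P Q : ℝ × ℝ} (hPQ : P ≠ Q) :
    ∃ l : MvPolynomial (Fin 2) ℝ, l.totalDegree ≤ 1 ∧ ev l Q = 0 ∧ ev l P ≠ 0 := by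
  by_cases h : P.1 = Q.1
  · refine ⟨X 1 - C Q.2, (totalDegree_sub_C_le _ _).trans (by simp), by simp [ev], ?_⟩
    have : P.2 ≠ Q.2 := fun h2 => hPQ (Prod.ext h h2)
    simpa [ev, sub_eq_zero] using this
  · refine ⟨X 0 - C Q.1, (totalDegree_sub_C_le _ _).trans (by simp), by simp [ev], ?_⟩
    simpa [ev, sub_eq_zero] using h

lemma finrank_restrictTotalDegree (n : ℕ) :
    Module.finrank ℝ (restrictTotalDegree (Fin 2) ℝ n) =
      (((Finset.range (n + 1)) ×ˢ (Finset.range (n + 1))).filter fun p => p.1 + p.2 ≤ n).card := by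
  have h1 := Module.finrank_eq_nat_card_basis
    (basisRestrictSupport ℝ {d : Fin 2 →₀ ℕ | (d.sum fun _ e => e) ≤ n})
  refine h1.trans ?_
  have hmem : ∀ d : Fin 2 →₀ ℕ, (d.sum fun _ e => e) ≤ n ↔ d 0 + d 1 ≤ n := by
    intro d
    rw [Finsupp.sum_fintype _ _ (by simp), Fin.sum_univ_two]
  rw [← Nat.card_eq_finsetCard]
  refine Nat.card_eq_of_bijective (fun d => ⟨(d.1 0, d.1 1), ?_⟩) ⟨?_, ?_⟩
  · have := (hmem d.1).mp d.2
    simp only [Finset.mem_filter, Finset.mem_product, Finset.mem_range]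
    omega
  · rintro ⟨d, hd⟩ ⟨d', hd'⟩ h
    simp only [Subtype.mk.injEq, Prod.mk.injEq] at h ⊢
    ext i
    fin_cases i
    exacts [h.1, h.2]
  · rintro ⟨⟨i, j⟩, hij⟩
    simp only [Finset.mem_filter] at hij
    exact ⟨⟨Finsupp.single 0 i + Finsupp.single 1 j, (hmem _).mpr (by simpa using hij.2)⟩,
      by simp⟩

/-- Evaluation at finitely many points. -/
noncomputable def evalAt (S : Finset (ℝ × ℝ)) : MvPolynomial (Fin 2) ℝ →ₗ[ℝ] (S → ℝ) :=
  LinearMap.pi fun A => (aeval ![A.1.1, A.1.2]).toLinearMap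

lemma evalAt_apply (S : Finset (ℝ × ℝ)) (p : MvPolynomial (Fin 2) ℝ) (A : S) :
    evalAt S p A = ev p A := by
  simp [evalAt, ev, aeval_eq_eval]

lemma exists_ne_zero_vanishing (n : ℕ) (S : Finset (ℝ × ℝ))
    (hS : S.card < Module.finrank ℝ (restrictTotalDegree (Fin 2) ℝ n)) :
    ∃ p : MvPolynomial (Fin 2) ℝ, p ≠ 0 ∧ p.totalDegree ≤ n ∧ ∀ A ∈ S, ev p A = 0 := by
  have h1 : LinearMap.ker ((evalAt S).domRestrict (restrictTotalDegree (Fin 2) ℝ n)) ≠ ⊥ :=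
    LinearMap.ker_ne_bot_of_finrank_lt (by simpa using hS)
  obtain ⟨p, hp, hp0⟩ := Submodule.exists_mem_ne_zero_of_ne_bot h1
  refine ⟨p, by simpa using hp0, (mem_restrictTotalDegree _ _ _).mp p.2, fun A hA => ?_⟩
  have h2 := congrFun (LinearMap.mem_ker.mp hp) ⟨A, hA⟩
  rwa [LinearMap.domRestrict_apply, evalAt_apply] at h2

end PlanePolynomials

section RankBound

/-- The polynomials of degree at most `4` vanishing on `T`. -/
noncomputable def vanishing (T : Finset (ℝ × ℝ)) :
    Submodule ℝ (restrictTotalDegree (Fin 2) ℝ 4) :=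
  LinearMap.ker ((evalAt T).domRestrict (restrictTotalDegree (Fin 2) ℝ 4))

lemma mem_vanishing {T : Finset (ℝ × ℝ)} {p : restrictTotalDegree (Fin 2) ℝ 4} :
    p ∈ vanishing T ↔ ∀ A ∈ T, ev p A = 0 := by
  rw [vanishing, LinearMap.mem_ker, LinearMap.domRestrict_apply, funext_iff]
  simp [evalAt_apply]

/-- The dimension of the space of polynomials of degree at most `4` vanishing on `T`. -/
noncomputable def vanishingDim (T : Finset (ℝ × ℝ)) : ℕ := Module.finrank ℝ (vanishing T)

lemma vanishingDim_empty_le : vanishingDim ∅ ≤ 15 :=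
  (Submodule.finrank_le _).trans ((finrank_restrictTotalDegree 4).trans (by decide)).le

lemma vanishingDim_insert {T : Finset (ℝ × ℝ)} {A : ℝ × ℝ} {p : MvPolynomial (Fin 2) ℝ}
    (hp : p.totalDegree ≤ 4) (hT : ∀ B ∈ T, ev p B = 0) (hA : ev p A ≠ 0) :
    vanishingDim (insert A T) + 1 ≤ vanishingDim T := by
  apply Submodule.finrank_lt_finrank_of_lt
  refine lt_of_le_of_ne (fun q hq => ?_) fun heq => ?_
  · rw [mem_vanishing] at hq ⊢
    exact fun B hB => hq B (Finset.mem_insert_of_mem hB)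
  · have h1 : (⟨p, (mem_restrictTotalDegree _ _ _).mpr hp⟩ :
        restrictTotalDegree (Fin 2) ℝ 4) ∈ vanishing T := mem_vanishing.mpr hT
    rw [← heq, mem_vanishing] at h1
    exact hA (h1 A (Finset.mem_insert_self A T))

lemma vanishingDim_union {T : Finset (ℝ × ℝ)} {g : MvPolynomial (Fin 2) ℝ} {i j : ℕ}
    (hg : g.totalDegree ≤ i) (hij : i + j ≤ 4) (hT : ∀ B ∈ T, ev g B = 0)
    (S : Finset (ℝ × ℝ)) (hS : ∀ B ∈ S, ev g B ≠ 0) (hcard : S.card ≤ j + 1) :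
    vanishingDim (S ∪ T) + S.card ≤ vanishingDim T := by
  induction S using Finset.induction_on with
  | empty => simp
  | insert A S hA ih =>
    rw [Finset.card_insert_of_notMem hA] at hcard ⊢
    have h1 := ih (fun B hB => hS B (Finset.mem_insert_of_mem hB)) (by omega)
    have hsep : ∀ B : ℝ × ℝ, ∃ l : MvPolynomial (Fin 2) ℝ,
        B ≠ A → l.totalDegree ≤ 1 ∧ ev l B = 0 ∧ ev l A ≠ 0 := by
      intro B
      by_cases hB : B = A
      · exact ⟨0, fun h => absurd hB h⟩
      · obtain ⟨l, hl⟩ := exists_separating (Ne.symm hB)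
        exact ⟨l, fun _ => hl⟩
    choose l hl using hsep
    have hne : ∀ B ∈ S, B ≠ A := by
      rintro B hB rfl
      exact hA hB
    have h2 : vanishingDim (insert A (S ∪ T)) + 1 ≤ vanishingDim (S ∪ T) := by
      refine vanishingDim_insert (p := g * ∏ B ∈ S, l B) ?_ ?_ ?_
      · exact (totalDegree_mul_le_of_le hg (totalDegree_prod_le_card S l
          fun B hB => (hl B (hne B hB)).1)).trans (by omega)
      · intro B hB
        rw [ev_mul, ev_prod]
        rcases Finset.mem_union.mp hB with hB | hB
        · exact mul_eq_zero_of_right _ (Finset.prod_eq_zero (f := fun C => ev (l C) B) hB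
            (hl B (hne B hB)).2.1)
        · rw [hT B hB, zero_mul]
      · rw [ev_mul, ev_prod]
        exact mul_ne_zero (hS A (Finset.mem_insert_self A S))
          (Finset.prod_ne_zero_iff.mpr fun B hB => (hl B (hne B hB)).2.2)
    rw [Finset.insert_union]
    omega

/-- One more line `m` in a sequence of lines with product `g`: as many as `j + 1` of the nodes
on `m` but not on the earlier lines impose independent conditions. -/
lemma exists_layer {T S : Finset (ℝ × ℝ)} {g : MvPolynomial (Fin 2) ℝ} {i j : ℕ}
    (hg : g.totalDegree ≤ i) (hij : i + j ≤ 4) (hT : ∀ B ∈ T, ev g B = 0)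
    (hS : ∀ B ∈ S, ev g B ≠ 0) :
    ∃ S' ⊆ S, vanishingDim (S' ∪ T) + min S.card (j + 1) ≤ vanishingDim T := by
  obtain ⟨S', hS', hcard⟩ := Finset.exists_subset_card_eq (min_le_left S.card (j + 1))
  refine ⟨S', hS', ?_⟩
  rw [← hcard]
  exact vanishingDim_union hg hij hT S' (fun B hB => hS B (hS' hB)) (by omega)

lemma vanishingDim_users {T U : Finset (ℝ × ℝ)} (q : ℝ × ℝ → MvPolynomial (Fin 2) ℝ)
    (hdeg : ∀ A ∈ U, (q A).totalDegree ≤ 4) (hqA : ∀ A ∈ U, ev (q A) A ≠ 0)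
    (hqT : ∀ A ∈ U, ∀ B ∈ T, ev (q A) B = 0) (hqU : ∀ A ∈ U, ∀ B ∈ U, B ≠ A → ev (q A) B = 0) :
    U.card ≤ vanishingDim T := by
  suffices h : ∀ V ⊆ U, vanishingDim (V ∪ T) + V.card ≤ vanishingDim T by
    have := h U subset_rfl
    omega
  intro V
  induction V using Finset.induction_on with
  | empty => simp
  | insert A V hA ih =>
    intro hV
    have hAU := hV (Finset.mem_insert_self A V)
    have hVU : V ⊆ U := (Finset.subset_insert A V).trans hV
    have h1 := ih hVU
    have h2 : vanishingDim (insert A (V ∪ T)) + 1 ≤ vanishingDim (V ∪ T) := by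
      refine vanishingDim_insert (hdeg A hAU) (fun B hB => ?_) (hqA A hAU)
      rcases Finset.mem_union.mp hB with hB | hB
      · exact hqU A hAU B (hVU hB) (by rintro rfl; exact hA hB)
      · exact hqT A hAU B hB
    rw [Finset.card_insert_of_notMem hA, Finset.insert_union]
    omega

/-- Four lines covering `Z`, taken in order, give layers whose truncated sizes bound
the number of nodes with a quartic fundamental polynomial vanishing on `Z`. -/
lemma layers_add_card_le {Z U : Finset (ℝ × ℝ)} (m : Fin 4 → MvPolynomial (Fin 2) ℝ)
    (hm : ∀ i, (m i).totalDegree ≤ 1) (S : Fin 4 → Finset (ℝ × ℝ)) (hSZ : ∀ i, S i ⊆ Z)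
    (hSm : ∀ i, ∀ B ∈ S i, ev (m i) B = 0) (hSlt : ∀ i j, j < i → ∀ B ∈ S i, ev (m j) B ≠ 0)
    (q : ℝ × ℝ → MvPolynomial (Fin 2) ℝ)
    (hdeg : ∀ A ∈ U, (q A).totalDegree ≤ 4) (hqA : ∀ A ∈ U, ev (q A) A ≠ 0)
    (hqZ : ∀ A ∈ U, ∀ B ∈ Z, ev (q A) B = 0) (hqU : ∀ A ∈ U, ∀ B ∈ U, B ≠ A → ev (q A) B = 0) :
    min (S 0).card 5 + min (S 1).card 4 + min (S 2).card 3 + min (S 3).card 2 + U.card ≤ 15 := by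
  obtain ⟨T₀, hT₀, h₀⟩ := exists_layer (T := ∅) (S := S 0) (g := 1) (i := 0) (j := 4)
    (by simp) (by norm_num) (by simp) (by simp [ev])
  obtain ⟨T₁, hT₁, h₁⟩ := exists_layer (T := T₀ ∪ ∅) (S := S 1) (g := m 0) (i := 1) (j := 3)
    (hm 0) (by norm_num) (by simpa using fun B hB => hSm 0 B (hT₀ hB))
    (hSlt 1 0 (by decide))
  obtain ⟨T₂, hT₂, h₂⟩ := exists_layer (T := T₁ ∪ (T₀ ∪ ∅)) (S := S 2) (g := m 0 * m 1)
    (i := 2) (j := 2) (totalDegree_mul_le_of_le (hm 0) (hm 1)) (by norm_num)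
    (by
      intro B hB
      simp only [Finset.mem_union, Finset.notMem_empty, or_false] at hB
      rw [ev_mul]
      rcases hB with hB | hB
      · rw [hSm 1 B (hT₁ hB), mul_zero]
      · rw [hSm 0 B (hT₀ hB), zero_mul])
    (by
      intro B hB
      rw [ev_mul]
      exact mul_ne_zero (hSlt 2 0 (by decide) B hB) (hSlt 2 1 (by decide) B hB))
  obtain ⟨T₃, hT₃, h₃⟩ := exists_layer (T := T₂ ∪ (T₁ ∪ (T₀ ∪ ∅))) (S := S 3)
    (g := m 0 * m 1 * m 2) (i := 3) (j := 1)
    (totalDegree_mul_le_of_le (totalDegree_mul_le_of_le (hm 0) (hm 1)) (hm 2)) (by norm_num)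
    (by
      intro B hB
      simp only [Finset.mem_union, Finset.notMem_empty, or_false] at hB
      rw [ev_mul, ev_mul]
      rcases hB with hB | hB | hB
      · rw [hSm 2 B (hT₂ hB), mul_zero]
      · rw [hSm 1 B (hT₁ hB), mul_zero, zero_mul]
      · rw [hSm 0 B (hT₀ hB), zero_mul, zero_mul])
    (by
      intro B hB
      rw [ev_mul, ev_mul]
      exact mul_ne_zero (mul_ne_zero (hSlt 3 0 (by decide) B hB) (hSlt 3 1 (by decide) B hB))
        (hSlt 3 2 (by decide) B hB))
  have h₄ := vanishingDim_users (T := T₃ ∪ (T₂ ∪ (T₁ ∪ (T₀ ∪ ∅)))) q hdeg hqA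
    (by
      intro A hA B hB
      simp only [Finset.mem_union, Finset.notMem_empty, or_false] at hB
      apply hqZ A hA
      rcases hB with hB | hB | hB | hB
      exacts [hSZ 3 (hT₃ hB), hSZ 2 (hT₂ hB), hSZ 1 (hT₁ hB), hSZ 0 (hT₀ hB)]) hqU
  have := vanishingDim_empty_le
  norm_num at h₀ h₁ h₂ h₃ h₄
  omega

end RankBound

lemma exists_greedy {ι P : Type*} [DecidableEq ι] [DecidableEq P] {J : Finset ι}
    (hJ : J.card = 4) {Z : Finset P} {b : ι → Finset P} (hb : ∀ C ∈ Z, ∃ i ∈ J, C ∈ b i) :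
    ∃ (σ : Fin 4 → ι) (S : Fin 4 → Finset P), Function.Injective σ ∧ (∀ k, σ k ∈ J) ∧
      (∀ k, S k ⊆ Z) ∧ (∀ k, S k ⊆ b (σ k)) ∧ (∀ k j, j < k → Disjoint (S k) (b (σ j))) ∧
      (S 0).card + (S 1).card + (S 2).card + (S 3).card = Z.card ∧
      (S 1).card ≤ (S 0).card ∧ (S 2).card ≤ (S 1).card ∧ (S 3).card ≤ (S 2).card := by
  obtain ⟨i, hi, hi'⟩ := J.exists_max_image (fun i => (Z ∩ b i).card)
    (Finset.card_pos.mp (by omega))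
  have hc1 := Finset.card_erase_of_mem hi
  obtain ⟨j, hj, hj'⟩ := (J.erase i).exists_max_image (fun k => ((Z \ b i) ∩ b k).card)
    (Finset.card_pos.mp (by omega))
  have hc2 := Finset.card_erase_of_mem hj
  obtain ⟨k, hk, hk'⟩ := ((J.erase i).erase j).exists_max_image
    (fun k => (((Z \ b i) \ b j) ∩ b k).card) (Finset.card_pos.mp (by omega))
  have hc3 := Finset.card_erase_of_mem hk
  obtain ⟨l, hl⟩ := Finset.card_eq_one.mp (show (((J.erase i).erase j).erase k).card = 1 by omega)
  have hl' : l ∈ ((J.erase i).erase j).erase k := by simp [hl]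
  have hall : ∀ m ∈ J, m = i ∨ m = j ∨ m = k ∨ m = l := by
    intro m hm
    by_contra! hcon
    have : m ∈ ((J.erase i).erase j).erase k := by simp [hcon, hm]
    rw [hl, Finset.mem_singleton] at this
    exact hcon.2.2.2 this
  simp only [Finset.mem_erase] at hj hk hl'
  have hlast : (((Z \ b i) \ b j) \ b k) ∩ b l = ((Z \ b i) \ b j) \ b k := by
    rw [Finset.inter_eq_left]
    intro C hC
    simp only [Finset.mem_sdiff] at hC
    obtain ⟨m, hm, hCm⟩ := hb C hC.1.1.1
    rcases hall m hm with rfl | rfl | rfl | rfl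
    exacts [absurd hCm hC.1.1.2, absurd hCm hC.1.2, absurd hCm hC.2, hCm]
  refine ⟨![i, j, k, l], ![Z ∩ b i, (Z \ b i) ∩ b j, ((Z \ b i) \ b j) ∩ b k,
    (((Z \ b i) \ b j) \ b k) ∩ b l], ?_, ?_, ?_, ?_, ?_, ?_, ?_, ?_, ?_⟩
  · intro a c hac
    fin_cases a <;> fin_cases c <;> simp_all
  · simp [Fin.forall_fin_succ, hi, hj, hk, hl']
  · intro m
    fin_cases m <;> intro C hC <;> simp_all
  · intro m
    fin_cases m <;> exact Finset.inter_subset_right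
  · intro m n hmn
    rw [Finset.disjoint_left]
    fin_cases m <;> fin_cases n <;> first | exact absurd hmn (by decide) | skip
    all_goals
      intro C hC
      simp at hC
      simp [hC]
  · have h1 := Finset.card_inter_add_card_sdiff Z (b i)
    have h2 := Finset.card_inter_add_card_sdiff (Z \ b i) (b j)
    have h3 := Finset.card_inter_add_card_sdiff ((Z \ b i) \ b j) (b k)
    simp only [Matrix.cons_val, hlast]
    omega
  · refine le_trans (Finset.card_le_card ?_) (hi' j hj.2)
    exact Finset.inter_subset_inter_right Finset.sdiff_subset
  · refine le_trans (Finset.card_le_card ?_) (hj' k (Finset.mem_erase.mpr hk.2))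
    exact Finset.inter_subset_inter_right Finset.sdiff_subset
  · refine le_trans (Finset.card_le_card ?_)
      (hk' l (Finset.mem_erase.mpr ⟨hl'.2.1, Finset.mem_erase.mpr hl'.2.2⟩))
    exact Finset.inter_subset_inter_right Finset.sdiff_subset

section GCData

/-- The nodes of `X` on the line `l`. -/
noncomputable def block (X : Finset (ℝ × ℝ)) (l : MvPolynomial (Fin 2) ℝ) : Finset (ℝ × ℝ) :=
  X.filter fun A => ev l A = 0

/-- The node sets of the five lines whose product is a multiple of the fundamental polynomial
of `A`. -/
noncomputable def usedLines (X : Finset (ℝ × ℝ)) (f : ℝ × ℝ → Fin 5 → MvPolynomial (Fin 2) ℝ)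
    (A : ℝ × ℝ) : Finset (Finset (ℝ × ℝ)) :=
  Finset.univ.image fun i => block X (f A i)

/-- A `GC_5` set without maximal line, with the factors of its fundamental polynomials. -/
structure GCData (X : Finset (ℝ × ℝ)) (f : ℝ × ℝ → Fin 5 → MvPolynomial (Fin 2) ℝ) : Prop where
  card_nodes : X.card = 21
  poised : ∀ p : MvPolynomial (Fin 2) ℝ, p.totalDegree ≤ 5 → (∀ A ∈ X, ev p A = 0) → p = 0
  isLine : ∀ A ∈ X, ∀ i, IsLinePoly (f A i)
  self_ne : ∀ A ∈ X, ∀ i, ev (f A i) A ≠ 0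
  cover : ∀ A ∈ X, ∀ B ∈ X, B ≠ A → ∃ i, ev (f A i) B = 0
  card_ne_six : ∀ l, IsLinePoly l → (block X l).card ≠ 6

variable {X : Finset (ℝ × ℝ)} {f : ℝ × ℝ → Fin 5 → MvPolynomial (Fin 2) ℝ}

lemma mem_block {l : MvPolynomial (Fin 2) ℝ} {A : ℝ × ℝ} :
    A ∈ block X l ↔ A ∈ X ∧ ev l A = 0 := by simp [block]

lemma block_eq_of_two {l l' : MvPolynomial (Fin 2) ℝ} (hl : IsLinePoly l) (hl' : IsLinePoly l')
    {P Q : ℝ × ℝ} (hPQ : P ≠ Q) (hP : ev l P = 0) (hQ : ev l Q = 0) (hP' : ev l' P = 0)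
    (hQ' : ev l' Q = 0) : block X l = block X l' := by
  ext R
  rw [mem_block, mem_block, ev_eq_zero_iff hl hl' hPQ hP hQ hP' hQ']

lemma mem_usedLines {h : Finset (ℝ × ℝ)} {A : ℝ × ℝ} :
    h ∈ usedLines X f A ↔ ∃ i, block X (f A i) = h := by simp [usedLines]

lemma IsLinePoly.ne_zero {l : MvPolynomial (Fin 2) ℝ} (hl : IsLinePoly l) : l ≠ 0 := by
  rintro rfl
  simp [IsLinePoly] at hl

namespace GCData

variable (hg : GCData X f)
include hg

lemma prod_erase_eq_zero {A : ℝ × ℝ} (hA : A ∈ X) {i : Fin 5} {B : ℝ × ℝ} (hB : B ∈ X)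
    (hBA : B ≠ A) (hi : ev (f A i) B ≠ 0) : ev (∏ j ∈ Finset.univ.erase i, f A j) B = 0 := by
  obtain ⟨j, hj⟩ := hg.cover A hA B hB hBA
  rw [ev_prod]
  apply Finset.prod_eq_zero (i := j) _ hj
  simp only [Finset.mem_erase, Finset.mem_univ, and_true]
  rintro rfl
  exact hi hj

lemma prod_erase_ne_zero {A : ℝ × ℝ} (hA : A ∈ X) (i : Fin 5) :
    ev (∏ j ∈ Finset.univ.erase i, f A j) A ≠ 0 := by
  rw [ev_prod]
  exact Finset.prod_ne_zero_iff.mpr fun j _ => hg.self_ne A hA j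

lemma totalDegree_prod_erase_le {A : ℝ × ℝ} (hA : A ∈ X) (i : Fin 5) :
    (∏ j ∈ Finset.univ.erase i, f A j).totalDegree ≤ 4 :=
  (totalDegree_prod_le_card _ _ fun j _ => (hg.isLine A hA j).le).trans (by simp)

/-- Each line used by `A` has two nodes on none of the other lines used by `A`. -/
lemma two_le_card_private {A : ℝ × ℝ} (hA : A ∈ X) (i : Fin 5) :
    2 ≤ ((X.erase A).filter fun B => ∀ j, j ≠ i → ev (f A j) B ≠ 0).card := by
  set S := (X.erase A).filter fun B => ∀ j, j ≠ i → ev (f A j) B ≠ 0 with hS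
  by_contra! hlt
  obtain ⟨l, hl0, hldeg, hl⟩ := exists_ne_zero_vanishing 1 (insert A S) (by
    rw [finrank_restrictTotalDegree]
    refine (Finset.card_insert_le A S).trans_lt (lt_of_lt_of_le (b := 3) (by omega) ?_)
    decide)
  have h1 := hg.poised ((∏ j ∈ Finset.univ.erase i, f A j) * l)
    (totalDegree_mul_le_of_le (hg.totalDegree_prod_erase_le hA i) hldeg) (by
      intro B hB
      rw [ev_mul]
      by_cases hBS : B ∈ insert A S
      · rw [hl B hBS, mul_zero]
      · simp only [hS, Finset.mem_insert, Finset.mem_filter, Finset.mem_erase, hB, not_or] at hBS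
        have h2 := hBS.2
        simp only [hBS.1, not_false_eq_true, and_true, ne_eq, true_and, not_forall,
          not_not] at h2
        obtain ⟨j, hji, hj⟩ := h2
        rw [ev_prod, Finset.prod_eq_zero (i := j) (by simp [hji]) hj, zero_mul])
  rcases mul_eq_zero.mp h1 with h2 | h2
  · apply hg.prod_erase_ne_zero hA i
    rw [h2]
    simp [ev]
  · exact hl0 h2

lemma ev_eq_zero_of_private {A B : ℝ × ℝ} (hA : A ∈ X) {i : Fin 5}
    (hB : B ∈ (X.erase A).filter fun B => ∀ j, j ≠ i → ev (f A j) B ≠ 0) : ev (f A i) B = 0 := by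
  simp only [Finset.mem_filter, Finset.mem_erase] at hB
  obtain ⟨j, hj⟩ := hg.cover A hA B hB.1.2 hB.1.1
  by_cases hji : j = i
  · rwa [← hji]
  · exact absurd hj (hB.2 j hji)

lemma block_injective {A : ℝ × ℝ} (hA : A ∈ X) :
    Function.Injective fun i => block X (f A i) := by
  intro i j hij
  by_contra hne
  obtain ⟨B, hB⟩ := Finset.card_pos.mp (zero_lt_two.trans_le (hg.two_le_card_private hA i))
  have h1 := hg.ev_eq_zero_of_private hA hB
  simp only [Finset.mem_filter, Finset.mem_erase] at hB
  have h2 : B ∈ block X (f A j) := by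
    rw [← show block X (f A i) = block X (f A j) from hij]
    exact mem_block.mpr ⟨hB.1.2, h1⟩
  exact hB.2 j (Ne.symm hne) (mem_block.mp h2).2

lemma two_le_card_block {A : ℝ × ℝ} (hA : A ∈ X) (i : Fin 5) :
    2 ≤ (block X (f A i)).card := by
  refine (hg.two_le_card_private hA i).trans (Finset.card_le_card fun B hB => ?_)
  have h1 := hg.ev_eq_zero_of_private hA hB
  simp only [Finset.mem_filter, Finset.mem_erase] at hB
  exact mem_block.mpr ⟨hB.1.2, h1⟩

lemma card_block_le_five {l : MvPolynomial (Fin 2) ℝ} (hl : IsLinePoly l) :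
    (block X l).card ≤ 5 := by
  by_contra! hlt
  have h6 := hg.card_ne_six l hl
  obtain ⟨A, hA⟩ := Finset.card_pos.mp (by omega : 0 < (block X l).card)
  have hA' := mem_block.mp hA
  have hcov : ∀ B : ℝ × ℝ, ∃ i, B ∈ (block X l).erase A → ev (f A i) B = 0 := by
    intro B
    by_cases hB : B ∈ (block X l).erase A
    · rw [Finset.mem_erase, mem_block] at hB
      obtain ⟨i, hi⟩ := hg.cover A hA'.1 B hB.2.1 hB.1
      exact ⟨i, fun _ => hi⟩
    · exact ⟨0, fun h => absurd h hB⟩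
  choose c hc using hcov
  obtain ⟨B, hB, C, hC, hne, heq⟩ := Finset.exists_ne_map_eq_of_card_lt_of_maps_to
    (s := (block X l).erase A) (t := Finset.univ) (f := c)
    (by rw [Finset.card_erase_of_mem hA, Finset.card_univ, Fintype.card_fin]; omega) (by simp)
  have hB0 := hc B hB
  have hC0 := hc C hC
  rw [← heq] at hC0
  rw [Finset.mem_erase, mem_block] at hB hC
  exact hg.self_ne A hA'.1 (c B)
    ((ev_eq_zero_iff hl (hg.isLine A hA'.1 (c B)) hne hB.2.2 hC.2.2 hB0 hC0 A).mp hA'.2)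

lemma exists_of_mem_lines {h : Finset (ℝ × ℝ)} (hh : h ∈ lines X (usedLines X f)) :
    ∃ l, IsLinePoly l ∧ block X l = h := by
  obtain ⟨A, hA, hAh⟩ := mem_lines.mp hh
  obtain ⟨i, hi⟩ := mem_usedLines.mp hAh
  exact ⟨f A i, hg.isLine A hA i, hi⟩

lemma notMem_of_mem {A : ℝ × ℝ} (hA : A ∈ X) {h : Finset (ℝ × ℝ)} (hh : h ∈ usedLines X f A) :
    A ∉ h := by
  obtain ⟨i, rfl⟩ := mem_usedLines.mp hh
  exact fun hAi => hg.self_ne A hA i (mem_block.mp hAi).2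

lemma exists_quartic {A : ℝ × ℝ} (hA : A ∈ X) {h : Finset (ℝ × ℝ)} (hh : h ∈ usedLines X f A) :
    ∃ q : MvPolynomial (Fin 2) ℝ, q.totalDegree ≤ 4 ∧ ev q A ≠ 0 ∧
      ∀ B ∈ X, B ∉ h → B ≠ A → ev q B = 0 := by
  obtain ⟨i, rfl⟩ := mem_usedLines.mp hh
  refine ⟨_, hg.totalDegree_prod_erase_le hA i, hg.prod_erase_ne_zero hA i, ?_⟩
  intro B hB hBi hBA
  exact hg.prod_erase_eq_zero hA hB hBA fun h0 => hBi (mem_block.mpr ⟨hB, h0⟩)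

/-- The other four lines used by a node that uses `h`, ordered greedily. -/
lemma exists_layers {A : ℝ × ℝ} (hA : A ∈ X) {h : Finset (ℝ × ℝ)} (hh : h ∈ usedLines X f A) :
    ∃ (b : Fin 4 → Finset (ℝ × ℝ)) (s : Fin 4 → ℕ), Function.Injective b ∧
      (∀ k, b k ∈ usedLines X f A) ∧ (∀ k, s k = 5 → (b k).card = 5 ∧ Disjoint (b k) h) ∧
      (∀ k j, j < k → s k = 5 → Disjoint (b k) (b j)) ∧
      s 0 + s 1 + s 2 + s 3 + h.card + (users X (usedLines X f) h).card = 21 ∧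
      s 1 ≤ s 0 ∧ s 2 ≤ s 1 ∧ s 3 ≤ s 2 ∧ s 0 ≤ 5 ∧
      min (s 0) 5 + min (s 1) 4 + min (s 2) 3 + min (s 3) 2 +
        (users X (usedLines X f) h).card ≤ 15 := by
  set U := users X (usedLines X f) h with hU
  have hUX : U ⊆ X := Finset.filter_subset _ _
  have hUmem : ∀ B ∈ U, B ∈ X ∧ h ∈ usedLines X f B := fun B hB => mem_users.mp hB
  have hUh : ∀ B ∈ U, B ∉ h := fun B hB => hg.notMem_of_mem (hUmem B hB).1 (hUmem B hB).2
  obtain ⟨i, hi⟩ := mem_usedLines.mp hh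
  have hhX : h ⊆ X := hi ▸ Finset.filter_subset _ _
  set Z := X \ (h ∪ U) with hZ
  have hZmem : ∀ B ∈ Z, B ∈ X ∧ B ∉ h ∧ B ∉ U := by
    intro B hB
    simpa [hZ] using hB
  have hAU : A ∈ U := mem_users.mpr ⟨hA, hh⟩
  have hZcard : Z.card + h.card + U.card = 21 := by
    have h1 : (h ∪ U).card = h.card + U.card := Finset.card_union_of_disjoint
      (Finset.disjoint_left.mpr fun B hB hB' => hUh B hB' hB)
    have h2 := Finset.card_sdiff_add_card_eq_card (Finset.union_subset hhX hUX)
    rw [← hZ, hg.card_nodes] at h2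
    omega
  obtain ⟨σ, S, hσ, hσJ, hSZ, hSb, hSd, hsum, h10, h21, h32⟩ :=
    exists_greedy (J := Finset.univ.erase i) (Z := Z) (b := fun k => block X (f A k))
      (by simp) (by
        intro B hB
        obtain ⟨hBX, hBh, hBU⟩ := hZmem B hB
        obtain ⟨j, hj⟩ := hg.cover A hA B hBX (by rintro rfl; exact hBU hAU)
        refine ⟨j, ?_, mem_block.mpr ⟨hBX, hj⟩⟩
        simp only [Finset.mem_erase, Finset.mem_univ, and_true]
        rintro rfl
        exact hBh (hi ▸ mem_block.mpr ⟨hBX, hj⟩))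
  have hle : ∀ k, (block X (f A (σ k))).card ≤ 5 := fun k =>
    hg.card_block_le_five (hg.isLine A hA (σ k))
  have heq : ∀ k, (S k).card = 5 → S k = block X (f A (σ k)) := fun k hk =>
    Finset.eq_of_subset_of_card_le (hSb k) (by rw [hk]; exact hle k)
  have hq : ∀ B : ℝ × ℝ, ∃ q : MvPolynomial (Fin 2) ℝ, B ∈ U → q.totalDegree ≤ 4 ∧ ev q B ≠ 0 ∧
      ∀ C ∈ X, C ∉ h → C ≠ B → ev q C = 0 := by
    intro B
    by_cases hB : B ∈ U
    · obtain ⟨q, hq⟩ := hg.exists_quartic (hUmem B hB).1 (hUmem B hB).2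
      exact ⟨q, fun _ => hq⟩
    · exact ⟨0, fun hB' => absurd hB' hB⟩
  choose q hq using hq
  have hbound := layers_add_card_le (Z := Z) (U := U) (fun k => f A (σ k))
    (fun k => (hg.isLine A hA (σ k)).le) S hSZ (fun k B hB => (mem_block.mp (hSb k hB)).2)
    (fun k j hjk B hB h0 => Finset.disjoint_left.mp (hSd k j hjk) hB
      (mem_block.mpr ⟨(hZmem B (hSZ k hB)).1, h0⟩))
    q (fun B hB => (hq B hB).1) (fun B hB => (hq B hB).2.1)
    (fun B hB C hC => (hq B hB).2.2 C (hZmem C hC).1 (hZmem C hC).2.1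
      (by rintro rfl; exact (hZmem C hC).2.2 hB))
    (fun B hB C hC hne => (hq B hB).2.2 C (hUX hC) (hUh C hC) hne)
  refine ⟨fun k => block X (f A (σ k)), fun k => (S k).card, (hg.block_injective hA).comp hσ,
    fun k => mem_usedLines.mpr ⟨σ k, rfl⟩, ?_, ?_, by beta_reduce; omega, h10, h21, h32,
    (Finset.card_le_card (hSb 0)).trans (hle 0), hbound⟩
  · intro k hk
    beta_reduce at hk ⊢
    rw [← heq k hk]
    exact ⟨hk, Finset.disjoint_left.mpr fun B hB => (hZmem B (hSZ k hB)).2.1⟩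
  · intro k j hjk hk
    beta_reduce at hk ⊢
    rw [← heq k hk]
    exact hSd k j hjk

/-- A line dividing a nonzero quintic that vanishes at all nodes but `A` is used by `A`. -/
lemma block_mem_usedLines {A : ℝ × ℝ} (hA : A ∈ X) {l r : MvPolynomial (Fin 2) ℝ}
    (hl : IsLinePoly l) (hdeg : (l * r).totalDegree ≤ 5) (h0 : l * r ≠ 0)
    (hv : ∀ B ∈ X, B ≠ A → ev (l * r) B = 0) : block X l ∈ usedLines X f A := by
  set p := ∏ i, f A i with hp
  have hpdeg : p.totalDegree ≤ 5 :=
    (totalDegree_prod_le_card _ _ fun j _ => (hg.isLine A hA j).le).trans (by simp)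
  have hpA : ev p A ≠ 0 := by
    rw [hp, ev_prod]
    exact Finset.prod_ne_zero_iff.mpr fun j _ => hg.self_ne A hA j
  have hpv : ∀ B ∈ X, B ≠ A → ev p B = 0 := by
    intro B hB hBA
    obtain ⟨j, hj⟩ := hg.cover A hA B hB hBA
    rw [hp, ev_prod]
    exact Finset.prod_eq_zero (Finset.mem_univ j) hj
  have hgA : ev (l * r) A ≠ 0 := by
    intro hz
    refine h0 (hg.poised _ hdeg fun B hB => ?_)
    by_cases hBA : B = A
    · rwa [hBA]
    · exact hv B hB hBA
  have hcomb : ∀ B, ev (C (ev (l * r) A) * p - C (ev p A) * (l * r)) B =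
      ev (l * r) A * ev p B - ev p A * ev (l * r) B := by
    intro B
    simp [ev]
  have hzero := hg.poised (C (ev (l * r) A) * p - C (ev p A) * (l * r))
    ((totalDegree_sub _ _).trans (max_le
      ((totalDegree_mul_le_of_le (m := 0) (by simp) hpdeg).trans (by simp))
      ((totalDegree_mul_le_of_le (m := 0) (by simp) hdeg).trans (by simp)))) (by
      intro B hB
      rw [hcomb]
      by_cases hBA : B = A
      · rw [hBA]
        ring
      · rw [hpv B hB hBA, hv B hB hBA]
        ring)
  obtain ⟨z, hzinj, hz⟩ := exists_injective_zeros hl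
  have hroot : ∀ s : ℝ, ∃ i, ev (f A i) (z s) = 0 := by
    intro s
    have h1 := hcomb (z s)
    rw [hzero, ev_mul l r (z s), hz s] at h1
    simp only [ev, map_zero, zero_mul, mul_zero, sub_zero] at h1
    have h2 : ev p (z s) = 0 := (mul_eq_zero.mp h1.symm).resolve_left hgA
    rw [hp, ev_prod] at h2
    obtain ⟨i, -, hi⟩ := Finset.prod_eq_zero_iff.mp h2
    exact ⟨i, hi⟩
  choose c hc using hroot
  obtain ⟨s, s', hne, heq⟩ := Finite.exists_ne_map_eq_of_infinite c
  have hs' := hc s'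
  rw [← heq] at hs'
  exact mem_usedLines.mpr ⟨c s, block_eq_of_two (hg.isLine A hA _) hl (hzinj.ne hne)
    (hc s) hs' (hz s) (hz s')⟩

lemma card_inter_le_one {h h' : Finset (ℝ × ℝ)} (hh : h ∈ lines X (usedLines X f))
    (hh' : h' ∈ lines X (usedLines X f)) (hne : h ≠ h') : (h ∩ h').card ≤ 1 := by
  obtain ⟨l, hl, rfl⟩ := hg.exists_of_mem_lines hh
  obtain ⟨l', hl', rfl⟩ := hg.exists_of_mem_lines hh'
  by_contra! hlt
  obtain ⟨P, hP, Q, hQ, hPQ⟩ := Finset.one_lt_card.mp hlt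
  simp only [Finset.mem_inter, mem_block] at hP hQ
  exact hne (block_eq_of_two hl hl' hPQ hP.1.2 hQ.1.2 hP.2.2 hQ.2.2)

section Triple

variable {t : Fin 3 → Finset (ℝ × ℝ)} (ht : IsTriple X (usedLines X f) t)
include ht

lemma card_rest_eq_six : (rest X t).card = 6 := by
  refine card_rest_of_card_eq hg.card_nodes ht fun i => ?_
  obtain ⟨l, -, h⟩ := hg.exists_of_mem_lines (ht.mem i)
  exact h ▸ Finset.filter_subset _ _

/-- The product of the three lines of a triple. -/
lemma exists_cubic : ∃ l : Fin 3 → MvPolynomial (Fin 2) ℝ, (∀ i, IsLinePoly (l i)) ∧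
    (∀ i, block X (l i) = t i) ∧ (∏ i, l i).totalDegree ≤ 3 ∧ ∏ i, l i ≠ 0 ∧
    ∀ B ∈ X, B ∉ rest X t → ev (∏ i, l i) B = 0 := by
  choose l hl hlt using fun i => hg.exists_of_mem_lines (ht.mem i)
  refine ⟨l, hl, hlt, (totalDegree_prod_le_card _ _ fun j _ => (hl j).le).trans (by simp),
    Finset.prod_ne_zero_iff.mpr fun i _ => (hl i).ne_zero, ?_⟩
  intro B hB hBr
  rw [mem_rest] at hBr
  push Not at hBr
  obtain ⟨i, hi⟩ := hBr hB
  rw [← hlt i, mem_block] at hi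
  rw [ev_prod]
  exact Finset.prod_eq_zero (Finset.mem_univ i) hi.2

/-- No conic passes through all the nodes outside a triple. -/
lemma exists_ev_ne_zero {c : MvPolynomial (Fin 2) ℝ} (hc : c.totalDegree ≤ 2) (h0 : c ≠ 0) :
    ∃ B ∈ rest X t, ev c B ≠ 0 := by
  by_contra! hcon
  obtain ⟨l, -, -, hdeg, hl0, hv⟩ := hg.exists_cubic ht
  refine mul_ne_zero hl0 h0 (hg.poised _ (totalDegree_mul_le_of_le hdeg hc) fun B hB => ?_)
  rw [ev_mul]
  by_cases hBr : B ∈ rest X t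
  · rw [hcon B hBr, mul_zero]
  · rw [hv B hB hBr, zero_mul]

lemma triple_mem {A : ℝ × ℝ} (hA : A ∈ rest X t) (i : Fin 3) : t i ∈ usedLines X f A := by
  obtain ⟨l, hl, hlt, hdeg, hl0, hv⟩ := hg.exists_cubic ht
  obtain ⟨c, hc0, hcdeg, hc⟩ := exists_ne_zero_vanishing 2 ((rest X t).erase A) (by
    rw [finrank_restrictTotalDegree, Finset.card_erase_of_mem hA, hg.card_rest_eq_six ht]
    decide)
  have hfac : l i * ((∏ j ∈ Finset.univ.erase i, l j) * c) = (∏ j, l j) * c := by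
    rw [← mul_assoc, Finset.mul_prod_erase _ _ (Finset.mem_univ i)]
  rw [← hlt i]
  apply hg.block_mem_usedLines (mem_rest.mp hA).1 (hl i)
    (r := (∏ j ∈ Finset.univ.erase i, l j) * c)
  · rw [hfac]
    exact totalDegree_mul_le_of_le hdeg hcdeg
  · rw [hfac]
    exact mul_ne_zero hl0 hc0
  · intro B hB hBA
    rw [hfac, ev_mul]
    by_cases hBr : B ∈ rest X t
    · rw [hc B (Finset.mem_erase.mpr ⟨hBA, hBr⟩), mul_zero]
    · rw [hv B hB hBr, zero_mul]

lemma mem_of_card_inter_eq_three {h : Finset (ℝ × ℝ)} (hh : h ∈ lines X (usedLines X f))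
    (h3 : (h ∩ rest X t).card = 3) {A : ℝ × ℝ} (hA : A ∈ rest X t) (hAh : A ∉ h) :
    h ∈ usedLines X f A := by
  obtain ⟨l, hl, hlt, hdeg, hl0, hv⟩ := hg.exists_cubic ht
  obtain ⟨m, hm, rfl⟩ := hg.exists_of_mem_lines hh
  obtain ⟨c, hc0, hcdeg, hc⟩ := exists_ne_zero_vanishing 1 ((rest X t \ block X m).erase A) (by
    rw [finrank_restrictTotalDegree, Finset.card_erase_of_mem (by simp [hA, hAh]),
      Finset.card_sdiff, h3, hg.card_rest_eq_six ht]
    decide)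
  apply hg.block_mem_usedLines (mem_rest.mp hA).1 hm (r := c * ∏ j, l j)
  · exact totalDegree_mul_le_of_le hm.le (totalDegree_mul_le_of_le hcdeg hdeg)
  · exact mul_ne_zero hm.ne_zero (mul_ne_zero hc0 hl0)
  · intro B hB hBA
    rw [ev_mul, ev_mul]
    by_cases hBr : B ∈ rest X t
    · by_cases hBm : B ∈ block X m
      · rw [(mem_block.mp hBm).2, zero_mul]
      · rw [hc B (by simp [hBA, hBr, hBm]), zero_mul, mul_zero]
    · rw [hv B hB hBr, mul_zero, mul_zero]

lemma card_inter_rest_le {h : Finset (ℝ × ℝ)} (hh : h ∈ lines X (usedLines X f)) :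
    (h ∩ rest X t).card ≤ 3 := by
  by_contra! hlt
  obtain ⟨m, hm, rfl⟩ := hg.exists_of_mem_lines hh
  obtain ⟨c, hc0, hcdeg, hc⟩ := exists_ne_zero_vanishing 1 (rest X t \ block X m) (by
    rw [finrank_restrictTotalDegree, Finset.card_sdiff, hg.card_rest_eq_six ht]
    refine lt_of_lt_of_le (b := 3) (by omega) ?_
    decide)
  obtain ⟨B, hB, hBne⟩ := hg.exists_ev_ne_zero ht
    (totalDegree_mul_le_of_le (m := 1) (n := 1) hm.le hcdeg) (mul_ne_zero hm.ne_zero hc0)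
  apply hBne
  rw [ev_mul]
  by_cases hBm : B ∈ block X m
  · rw [(mem_block.mp hBm).2, zero_mul]
  · rw [hc B (by simp [hB, hBm]), mul_zero]

lemma not_rest_subset_union {h h' : Finset (ℝ × ℝ)} (hh : h ∈ lines X (usedLines X f))
    (hh' : h' ∈ lines X (usedLines X f)) : ¬ rest X t ⊆ h ∪ h' := by
  intro hsub
  obtain ⟨m, hm, rfl⟩ := hg.exists_of_mem_lines hh
  obtain ⟨m', hm', rfl⟩ := hg.exists_of_mem_lines hh'
  obtain ⟨B, hB, hBne⟩ := hg.exists_ev_ne_zero ht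
    (totalDegree_mul_le_of_le (m := 1) (n := 1) hm.le hm'.le) (mul_ne_zero hm.ne_zero hm'.ne_zero)
  apply hBne
  rw [ev_mul]
  rcases Finset.mem_union.mp (hsub hB) with h | h
  · rw [(mem_block.mp h).2, zero_mul]
  · rw [(mem_block.mp h).2, mul_zero]

end Triple

lemma exists_isTriple {A : ℝ × ℝ} (hA : A ∈ X) {a b c : Finset (ℝ × ℝ)}
    (ha : a ∈ usedLines X f A) (hb : b ∈ usedLines X f A) (hc : c ∈ usedLines X f A)
    (ha5 : a.card = 5) (hb5 : b.card = 5) (hc5 : c.card = 5) (hab : Disjoint a b)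
    (hac : Disjoint a c) (hbc : Disjoint b c) :
    ∃ t, IsTriple X (usedLines X f) t ∧ A ∈ rest X t := by
  refine ⟨![a, b, c], ⟨?_, ?_, ?_⟩, mem_rest.mpr ⟨hA, ?_⟩⟩
  · intro i
    fin_cases i
    exacts [mem_lines.mpr ⟨A, hA, ha⟩, mem_lines.mpr ⟨A, hA, hb⟩, mem_lines.mpr ⟨A, hA, hc⟩]
  · intro i
    fin_cases i
    exacts [ha5, hb5, hc5]
  · intro i j hij
    fin_cases i <;> fin_cases j <;> first | exact absurd rfl hij | skip
    exacts [hab, hac, hab.symm, hbc, hac.symm, hbc.symm]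
  · intro i
    fin_cases i
    exacts [hg.notMem_of_mem hA ha, hg.notMem_of_mem hA hb, hg.notMem_of_mem hA hc]

theorem lineSystem : LineSystem X (usedLines X f) where
  card_nodes := hg.card_nodes
  card_lines A hA := by
    rw [usedLines, Finset.card_image_of_injective _ (hg.block_injective hA)]
    simp
  subset A hA h hh := by
    obtain ⟨i, rfl⟩ := mem_usedLines.mp hh
    exact Finset.filter_subset _ _
  notMem A hA h hh := hg.notMem_of_mem hA hh
  two_le A hA h hh := by
    obtain ⟨i, rfl⟩ := mem_usedLines.mp hh
    exact hg.two_le_card_block hA i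
  le_five A hA h hh := by
    obtain ⟨i, rfl⟩ := mem_usedLines.mp hh
    exact hg.card_block_le_five (hg.isLine A hA i)
  cover A hA B hB hBA := by
    obtain ⟨i, hi⟩ := hg.cover A hA B hB hBA
    exact ⟨_, mem_usedLines.mpr ⟨i, rfl⟩, mem_block.mpr ⟨hB, hi⟩⟩
  inter_le_one h hh h' hh' hne := hg.card_inter_le_one hh hh' hne
  users_two A hA h hh hc := by
    obtain ⟨b, s, -, -, -, -, hsum, h10, h21, h32, h0, hle⟩ := hg.exists_layers hA hh
    omega
  users_three A hA h hh hc hu := by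
    obtain ⟨b, s, -, hb, h5, hd, hsum, h10, h21, h32, h0, hle⟩ := hg.exists_layers hA hh
    exact hg.exists_isTriple hA (hb 0) (hb 1) (hb 2) (h5 0 (by omega)).1 (h5 1 (by omega)).1
      (h5 2 (by omega)).1 (hd 1 0 (by decide) (by omega)).symm
      (hd 2 0 (by decide) (by omega)).symm (hd 2 1 (by decide) (by omega)).symm
  users_four A hA h hh hc := by
    obtain ⟨b, s, -, -, -, -, hsum, h10, h21, h32, h0, hle⟩ := hg.exists_layers hA hh
    omega
  users_four_eq A hA h hh hc hu := by
    obtain ⟨b, s, hinj, hb, h5, -, hsum, h10, h21, h32, h0, hle⟩ := hg.exists_layers hA hh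
    rw [Nat.succ_le_iff, Finset.one_lt_card]
    exact ⟨b 0, Finset.mem_filter.mpr ⟨hb 0, (h5 0 (by omega)).1⟩,
      b 1, Finset.mem_filter.mpr ⟨hb 1, (h5 1 (by omega)).1⟩, hinj.ne (by decide)⟩
  users_five_le A hA h hh hc := by
    obtain ⟨b, s, -, -, -, -, hsum, h10, h21, h32, h0, hle⟩ := hg.exists_layers hA hh
    omega
  users_five A hA h hh hc hu := by
    obtain ⟨b, s, -, hb, h5, hd, hsum, h10, h21, h32, h0, hle⟩ := hg.exists_layers hA hh
    exact hg.exists_isTriple hA hh (hb 0) (hb 1) hc (h5 0 (by omega)).1 (h5 1 (by omega)).1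
      (h5 0 (by omega)).2.symm (h5 1 (by omega)).2.symm (hd 1 0 (by decide) (by omega)).symm
  triple_mem t ht A hA i := hg.triple_mem ht hA i
  mem_of_three t ht h hh h3 A hA hAh := hg.mem_of_card_inter_eq_three ht hh h3 hA hAh
  inter_rest t ht h hh := hg.card_inter_rest_le ht hh
  not_cover t ht h hh h' hh' := hg.not_rest_subset_union ht hh hh'

end GCData

end GCData

/-- Every `GC_5` set of 21 nodes in the real plane possesses a maximal line,
i.e. a line passing through exactly 6 of its nodes. -/
theorem gasca_maeztu_conjecture_five (X : Set (ℝ × ℝ)) (hX : GCSet 5 X) :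
    ∃ l : MvPolynomial (Fin 2) ℝ, IsLinePoly l ∧ nodesOn X l = 6 := by
  classical
  by_contra! hno
  obtain ⟨⟨hfin, hcard, hpoised⟩, hfund⟩ := hX
  have hfactors : ∀ A, ∃ f : Fin 5 → MvPolynomial (Fin 2) ℝ, A ∈ X →
      (∀ i, IsLinePoly (f i)) ∧ IsFund 5 X A (∏ i, f i) := by
    intro A
    by_cases hA : A ∈ X
    · obtain ⟨_, hp, f, hf, rfl⟩ := hfund A hA
      exact ⟨f, fun _ => ⟨hf, hp⟩⟩
    · exact ⟨0, fun h => absurd h hA⟩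
  choose f hf using hfactors
  have hg : GCData hfin.toFinset f :=
    { card_nodes := by rw [← Set.ncard_eq_toFinset_card X hfin, hcard]
      poised := fun p hp h => hpoised p hp fun A hA => h A (hfin.mem_toFinset.mpr hA)
      isLine := fun A hA => (hf A (hfin.mem_toFinset.mp hA)).1
      self_ne := by
        intro A hA i h0
        have h1 := (hf A (hfin.mem_toFinset.mp hA)).2.2.1
        rw [ev_prod, Finset.prod_eq_zero (Finset.mem_univ i) h0] at h1
        exact zero_ne_one h1
      cover := by
        intro A hA B hB hBA
        have h0 := (hf A (hfin.mem_toFinset.mp hA)).2.2.2 B (hfin.mem_toFinset.mp hB) hBA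
        rw [ev_prod, Finset.prod_eq_zero_iff] at h0
        obtain ⟨i, -, hi⟩ := h0
        exact ⟨i, hi⟩
      card_ne_six := by
        intro l hl h6
        apply hno l hl
        rw [nodesOn, ← h6, ← Set.ncard_coe_finset]
        congr 1
        ext A
        simp [mem_block, lineSet] }
  exact hg.lineSystem.contradiction
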